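/- arXiv:2006.10871 — 4 statements merged into one kernel-verified Lean document; each statement's English description precedes it below -/
import Mathlib

section
/- Let R be a finite subset of ℤ^d, U its convex hull, and suppose 0 ∈ U; let U₀ be the unique face of U containing 0 in its relative interior and R₀ = R ∩ U₀. Suppose z₁, …, z_k ∈ R satisfy Σ_{i=1}^k z_i = 0. Then z_i ∈ R₀ for all i. Furthermore, if x = Σ_{i=1}^j z_i for some j ∈ {1,…,k−1}, and either x = Σ_{ℓ=1}^m z̃_ℓ or −x = Σ_{ℓ=1}^m z̃_ℓ for some z̃₁, …, z̃_m ∈ R, then z̃_ℓ ∈ R₀ for all ℓ. -/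
open MeasureTheory Filter Set
open scoped ENNReal NNReal Classical Topology

noncomputable section

namespace RWRP

abbrev Zd (d : ℕ) := Fin d → ℤ

variable {d : ℕ} {Ω : Type*} {Γ : Type*}

/-- Embedding of `ℤ^d` into `ℝ^d`. -/
def toR (x : Zd d) : Fin d → ℝ := fun i => (x i : ℝ)

/-- The `ℓ¹` norm on `ℝ^d`. -/
def n1 (ξ : Fin d → ℝ) : ℝ := ∑ i, |ξ i|

/-- The `ℓ¹` norm of a lattice point. -/
def n1Z (x : Zd d) : ℝ := n1 (toR x)

/-- `G₊`: the additive semigroup (ℤ₊-combinations) generated by the step set. -/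
def Gp (R : Finset (Zd d)) : Set (Zd d) := {x | ∃ b : Zd d → ℕ, x = ∑ z ∈ R, b z • z}

/-- `G(R')`: the additive group (ℤ-combinations) generated by `R'`. -/
def GZ (R : Finset (Zd d)) : Set (Zd d) := {x | ∃ b : Zd d → ℤ, x = ∑ z ∈ R, b z • z}

/-- ℤ₊-combinations of elements of a set of lattice points. -/
def GpS (S : Set (Zd d)) : Set (Zd d) :=
  {x | ∃ (m : ℕ) (c : Fin m → Zd d), (∀ i, c i ∈ S) ∧ x = ∑ i, c i}

/-- `C₊`: the real cone generated by the step set. -/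
def Cp (R : Finset (Zd d)) : Set (Fin d → ℝ) :=
  {ξ | ∃ b : Zd d → ℝ, (∀ z, 0 ≤ b z) ∧ ξ = ∑ z ∈ R, b z • toR z}

/-- `C'₊`: the rational cone generated by the step set. -/
def CpQ (R : Finset (Zd d)) : Set (Fin d → ℝ) :=
  {ξ | ∃ b : Zd d → ℚ, (∀ z, 0 ≤ b z) ∧ ξ = ∑ z ∈ R, (b z : ℝ) • toR z}

/-- `A` is a face of the convex set `K`. -/
def IsFace (K A : Set (Fin d → ℝ)) : Prop :=
  A ⊆ K ∧ Convex ℝ A ∧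
    ∀ ⦃ξ ζ η : Fin d → ℝ⦄ ⦃t : ℝ⦄, ξ ∈ A → ζ ∈ K → η ∈ K → t ∈ Set.Ioo (0:ℝ) 1 →
      ξ = t • ζ + (1 - t) • η → ζ ∈ A ∧ η ∈ A

/-- `U`: the convex hull of the step set. -/
def hullU (R : Finset (Zd d)) : Set (Fin d → ℝ) := convexHull ℝ (toR '' (R : Set (Zd d)))

/-- `U₀` is the face of `U` containing `0` in its relative interior (the empty set if `0 ∉ U`). -/
def IsZeroFace (R : Finset (Zd d)) (U₀ : Set (Fin d → ℝ)) : Prop :=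
  ((0 : Fin d → ℝ) ∈ hullU R ∧ IsFace (hullU R) U₀ ∧
    (0 : Fin d → ℝ) ∈ intrinsicInterior ℝ U₀) ∨
  ((0 : Fin d → ℝ) ∉ hullU R ∧ U₀ = ∅)

/-- `R₀ = R ∩ U₀`. -/
def R0 (R : Finset (Zd d)) (U₀ : Set (Fin d → ℝ)) : Set (Zd d) := {z | z ∈ R ∧ toR z ∈ U₀}

/-- `A_δ`: the directions in the face `A` at ℓ¹ distance `≥ δ` (after normalization) from the
relative boundary of `A`. -/
def faceDelta (A : Set (Fin d → ℝ)) (δ : ℝ) : Set (Fin d → ℝ) :=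
  {ξ | ξ ∈ A ∧ ξ ≠ 0 ∧
    ENNReal.ofReal δ ≤ ⨅ (η : Fin d → ℝ) (_ : η ∈ A \ intrinsicInterior ℝ A),
      ENNReal.ofReal (n1 ((n1 ξ)⁻¹ • ξ - η))}

/-- `U'_δ = {ξ ∈ U' : dist(ξ, U' ∖ relint Uall) ≥ δ}`. -/
def faceDeltaU (Uall U' : Set (Fin d → ℝ)) (δ : ℝ) : Set (Fin d → ℝ) :=
  {ξ | ξ ∈ U' ∧
    ENNReal.ofReal δ ≤ ⨅ (η : Fin d → ℝ) (_ : η ∈ U' \ intrinsicInterior ℝ Uall),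
      ENNReal.ofReal (n1 (ξ - η))}

/-- `D_n`: points reachable in exactly `n` admissible steps (counted with multiplicities). -/
def Dn (R : Finset (Zd d)) (n : ℕ) : Set (Zd d) :=
  {x | ∃ b : Zd d → ℕ, (∑ z ∈ R, b z) = n ∧ x = ∑ z ∈ R, b z • z}

/-- Position after `k` steps of the path with increments `f`, started at `x`. -/
def pos (x : Zd d) (f : ℕ → Zd d) (k : ℕ) : Zd d := x + ∑ i ∈ Finset.range k, f i

/-- Convert a finite tuple of admissible steps to an increment sequence. -/
def stepF {R : Finset (Zd d)} (n : ℕ) (s : Fin n → {z : Zd d // z ∈ R}) : ℕ → Zd d :=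
  fun i => if h : i < n then (s ⟨i, h⟩ : Zd d) else 0

/-- The path started at `x` with increments `f` hits `y` for the first time (after time `0`)
at time `n`. -/
def firstHit (x y : Zd d) (n : ℕ) (f : ℕ → Zd d) : Prop :=
  pos x f n = y ∧ ∀ k ∈ Finset.Ioo 0 n, pos x f k ≠ y

/-- Probability weight of a tuple of steps under the random walk kernel `p`. -/
def pathW (p : Zd d → ℝ) {R : Finset (Zd d)} {n : ℕ} (s : Fin n → {z : Zd d // z ∈ R}) : ℝ≥0∞ :=
  ∏ i, ENNReal.ofReal (p (s i : Zd d))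

/-- Total potential collected along the first `n` steps of a path. -/
def pathV (T : Zd d → Ω → Ω) (V : Ω → Zd d → ℝ) (ω : Ω) (x : Zd d) (n : ℕ)
    (f : ℕ → Zd d) : ℝ :=
  ∑ i ∈ Finset.range n, V (T (pos x f i) ω) (f i)

/-- `E_x[exp(-∑_{k<τ_y} V(T_{X_k}ω, Z_{k+1})) 1{τ_y < ∞}]`, as a sum over killed paths. -/
def walkK (T : Zd d → Ω → Ω) (V : Ω → Zd d → ℝ) (p : Zd d → ℝ) (R : Finset (Zd d))
    (ω : Ω) (x y : Zd d) : ℝ≥0∞ :=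
  ∑' n : ℕ, ∑ s : Fin (n+1) → {z : Zd d // z ∈ R},
    if firstHit x y (n+1) (stepF (n+1) s) then
      pathW p s * ENNReal.ofReal (Real.exp (-(pathV T V ω x (n+1) (stepF (n+1) s))))
    else 0

/-- The point-to-point quantity `a(ω,x,y)` (real-valued version, with junk values where the
underlying expectation is `0` or `∞`). -/
def aFun (T : Zd d → Ω → Ω) (V : Ω → Zd d → ℝ) (p : Zd d → ℝ) (R : Finset (Zd d))
    (ω : Ω) (x y : Zd d) : ℝ :=
  if y = x then 0 else - Real.log ((walkK T V p R ω x y).toReal)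

/-- The point-to-point quantity `a(ω,x,y)` with values in `[-∞,∞]`. -/
def aE (T : Zd d → Ω → Ω) (V : Ω → Zd d → ℝ) (p : Zd d → ℝ) (R : Finset (Zd d))
    (ω : Ω) (x y : Zd d) : EReal :=
  if y = x then (0 : EReal) else - (ENNReal.log (walkK T V p R ω x y))

/-- The zero-temperature quantity `a_∞(ω,x,y)`: the infimum of the total potential over
admissible paths from `x` to `y` that hit `y` for the first time at their last step. -/
def aInf (T : Zd d → Ω → Ω) (V : Ω → Zd d → ℝ) (R : Finset (Zd d))
    (ω : Ω) (x y : Zd d) : ℝ :=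
  if y = x then 0 else
    sInf {v : ℝ | ∃ n : ℕ, ∃ s : Fin (n+1) → {z : Zd d // z ∈ R},
      firstHit x y (n+1) (stepF (n+1) s) ∧ v = pathV T V ω x (n+1) (stepF (n+1) s)}

/-- The Green's function `g(ω,x,y)`, with values in `[0,∞]`. -/
def greenK (T : Zd d → Ω → Ω) (V : Ω → Zd d → ℝ) (p : Zd d → ℝ) (R : Finset (Zd d))
    (ω : Ω) (x y : Zd d) : ℝ≥0∞ :=
  (if y = x then 1 else 0) +
  ∑' n : ℕ, ∑ s : Fin (n+1) → {z : Zd d // z ∈ R},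
    if pos x (stepF (n+1) s) (n+1) = y then
      pathW p s * ENNReal.ofReal (Real.exp (-(pathV T V ω x (n+1) (stepF (n+1) s))))
    else 0

/-- `E_x[exp(-∑_{k<n} V) 1{X_n = y}]`: the restricted-length partition function. -/
def resK (T : Zd d → Ω → Ω) (V : Ω → Zd d → ℝ) (p : Zd d → ℝ) (R : Finset (Zd d))
    (ω : Ω) (n : ℕ) (x y : Zd d) : ℝ≥0∞ :=
  ∑ s : Fin n → {z : Zd d // z ∈ R},
    if pos x (stepF n s) n = y then
      pathW p s * ENNReal.ofReal (Real.exp (-(pathV T V ω x n (stepF n s))))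
    else 0

/-- `G_{x,(n),y} = log E_x[exp(-∑_{k<n} V) 1{X_n = y}]`. -/
def GRes (T : Zd d → Ω → Ω) (V : Ω → Zd d → ℝ) (p : Zd d → ℝ) (R : Finset (Zd d))
    (ω : Ω) (n : ℕ) (x y : Zd d) : ℝ :=
  Real.log ((resK T V p R ω n x y).toReal)

/-- The return probability `P₀(τ₀ < ∞)` of the reference walk. -/
def retP (p : Zd d → ℝ) (R : Finset (Zd d)) : ℝ≥0∞ :=
  ∑' n : ℕ, ∑ s : Fin (n+1) → {z : Zd d // z ∈ R},
    if firstHit (0 : Zd d) 0 (n+1) (stepF (n+1) s) then pathW p s else 0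

/-- `R_ε`: the ℓ¹-distance from the origin to the nearest point `x` of `G₊(S)` with
`V(T_x ω, z) ≥ ε` for some `z ∈ S`, as an element of `[0,∞]`. -/
def Reps (T : Zd d → Ω → Ω) (V : Ω → Zd d → ℝ) (S : Set (Zd d)) (ε : ℝ) (ω : Ω) : ℝ≥0∞ :=
  ⨅ (x : Zd d) (_ : x ∈ GpS S ∧ ∃ z ∈ S, ε ≤ V (T x ω) z), ENNReal.ofReal (n1Z x)

/-- The shift maps on a product space. -/
def shiftT (z : Zd d) (ω : Zd d → Γ) : Zd d → Γ := fun y => ω (z + y)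

/-- A function is locally Lipschitz (w.r.t. the ℓ¹ norm) on a set. -/
def LocLipOn (f : (Fin d → ℝ) → ℝ) (S : Set (Fin d → ℝ)) : Prop :=
  ∀ ξ ∈ S, ∃ K ε : ℝ, 0 < ε ∧ ∀ x ∈ S, ∀ y ∈ S,
    n1 (x - ξ) < ε → n1 (y - ξ) < ε → |f x - f y| ≤ K * n1 (x - y)

section measurable

variable [MeasurableSpace Ω]

/-- The σ-algebra of measurable sets invariant under the shifts `{T_z : z ∈ S}`. -/
def invSigma (T : Zd d → Ω → Ω) (S : Set (Zd d)) : MeasurableSpace Ω where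
  MeasurableSet' A := MeasurableSet A ∧ ∀ z ∈ S, T z ⁻¹' A = A
  measurableSet_empty := ⟨MeasurableSet.empty, fun _ _ => by simp⟩
  measurableSet_compl A hA := ⟨hA.1.compl, fun z hz => by
    rw [Set.preimage_compl, hA.2 z hz]⟩
  measurableSet_iUnion f hf := ⟨MeasurableSet.iUnion fun i => (hf i).1, fun z hz => by
    rw [Set.preimage_iUnion]
    exact Set.iUnion_congr fun i => (hf i).2 z hz⟩

/-- `ℙ` is ergodic under the shifts `{T_z : z ∈ S}`. -/
def ErgodicUnder (ℙ : Measure Ω) (T : Zd d → Ω → Ω) (S : Set (Zd d)) : Prop :=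
  ∀ A : Set Ω, MeasurableSet A → (∀ z ∈ S, T z ⁻¹' A = A) → ℙ A = 0 ∨ ℙ A = 1

/-- The class `𝓛_{z,R'}`. -/
def classL (ℙ : Measure Ω) (T : Zd d → Ω → Ω) (g : Ω → ℝ) (z : Zd d)
    (R' : Finset (Zd d)) : Prop :=
  ∀ᵐ ω ∂ℙ,
    (⨅ ε : {e : ℝ // 0 < e},
      Filter.limsup (fun n : ℕ =>
        ⨆ (x : Zd d) (_ : x ∈ Gp R' ∧ n1Z x ≤ n),
          (n : ℝ≥0∞)⁻¹ *
            ∑ k ∈ Finset.range (⌊(ε : ℝ) * n⌋₊ + 1), ENNReal.ofReal (g (T (x + k • z) ω)))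
        Filter.atTop) = 0

/-- Extended conditional expectation, with values in `[-∞,∞]`: the decreasing limit of the
conditional expectations of the truncations `max f (-n)`.  It agrees a.s. with the usual
conditional expectation in `[-∞,∞)` whenever `f⁺` is integrable. -/
def condExpE (ℙ : Measure Ω) (m : MeasurableSpace Ω) (f : Ω → ℝ) : Ω → EReal :=
  fun ω => ⨅ n : ℕ, ((MeasureTheory.condExp m ℙ (fun ω' => max (f ω') (-(n : ℝ))) ω : ℝ) : EReal)

/-- `EReal → ℝ≥0∞`, sending `[-∞,0]` to `0` and `⊤` to `⊤`. -/
def erealToENN (x : EReal) : ℝ≥0∞ := if x = ⊤ then ⊤ else ENNReal.ofReal x.toReal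

/-- `ᾱ(x) = inf_{n ≥ 1} (1/n) E[a(0,nx) | I_x]`, with `ᾱ(0) = 0`. -/
def alphaBar (ℙ : Measure Ω) (T : Zd d → Ω → Ω) (V : Ω → Zd d → ℝ) (p : Zd d → ℝ)
    (R : Finset (Zd d)) (x : Zd d) : Ω → EReal :=
  fun ω =>
    if x = 0 then 0 else
    ⨅ n : {m : ℕ // 0 < m},
      (((n : ℕ) : ℝ)⁻¹ : EReal) *
        condExpE ℙ (invSigma T {x}) (fun ω' => aFun T V p R ω' 0 ((n : ℕ) • x)) ω

/-- `x̂_t(ξ) = ∑_z ⌊tγ_z⌋ z`. -/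
def xhat (R : Finset (Zd d)) (γ : Zd d → ℝ) (t : ℝ) : Zd d := ∑ z ∈ R, ⌊t * γ z⌋ • z

/-- `tilde-α(ξ) = inf_{t ∈ ℚ, t>0} (1/t) E[a(0, x̂_t(ξ)) | 𝔖]`, where `𝔖` is the σ-algebra of
sets invariant under the shifts from `S`. -/
def tAlpha (ℙ : Measure Ω) (T : Zd d → Ω → Ω) (V : Ω → Zd d → ℝ) (p : Zd d → ℝ)
    (R : Finset (Zd d)) (S : Set (Zd d)) (γ : Zd d → ℝ) : Ω → EReal :=
  fun ω => ⨅ t : {q : ℚ // 0 < q},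
    ((((t : ℚ) : ℝ))⁻¹ : EReal) *
      condExpE ℙ (invSigma T S) (fun ω' => aFun T V p R ω' 0 (xhat R γ ((t : ℚ) : ℝ))) ω

/-- The σ-algebra `𝔖_ξ` of sets invariant under the shifts from `R_ξ = R ∩ C_ξ`. -/
def Sface (T : Zd d → Ω → Ω) (R : Finset (Zd d))
    (Cface : (Fin d → ℝ) → Set (Fin d → ℝ)) (ξ : Fin d → ℝ) : MeasurableSpace Ω :=
  invSigma T {z | z ∈ R ∧ toR z ∈ Cface ξ}

/-- `tilde-α` as a function of the direction `ξ`, given a choice `Cface` of the face `C_ξ`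
and a choice `γfun` of cone coefficients. -/
def tAlphaF (ℙ : Measure Ω) (T : Zd d → Ω → Ω) (V : Ω → Zd d → ℝ) (p : Zd d → ℝ)
    (R : Finset (Zd d)) (Cface : (Fin d → ℝ) → Set (Fin d → ℝ))
    (γfun : (Fin d → ℝ) → Zd d → ℝ) (ξ : Fin d → ℝ) : Ω → EReal :=
  fun ω => if ξ = 0 then 0 else tAlpha ℙ T V p R {z | z ∈ R ∧ toR z ∈ Cface ξ} (γfun ξ) ω

/-- `B` is an `L¹` covariant cocycle on the group generated by the allowed steps. -/
def IsCocycle (ℙ : Measure Ω) (T : Zd d → Ω → Ω) (S : Set (Zd d))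
    (B : Ω → Zd d → Zd d → ℝ) : Prop :=
  (∀ x y : Zd d, Measurable fun ω => B ω x y) ∧
  (∀ x ∈ S, ∀ y ∈ S, Integrable (fun ω => B ω x y) ℙ) ∧
  (∀ᵐ ω ∂ℙ, ∀ x ∈ S, ∀ y ∈ S, ∀ z ∈ S, B ω x y + B ω y z = B ω x z) ∧
  (∀ᵐ ω ∂ℙ, ∀ x ∈ S, ∀ y ∈ S, ∀ z ∈ S, B ω (x + z) (y + z) = B (T z ω) x y)

/-- The class `K⁺_A(V)` of centered cocycles. -/
def InKplus (ℙ : Measure Ω) (T : Zd d → Ω → Ω) (V : Ω → Zd d → ℝ) (p : Zd d → ℝ)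
    (R' : Finset (Zd d)) (B : Ω → Zd d → Zd d → ℝ) : Prop :=
  IsCocycle ℙ T (GZ R') B ∧
  ∀ᵐ ω ∂ℙ, ∑ z ∈ R', p z * Real.exp (-(V ω z) - B ω 0 z) ≤ 1

/-- The standing setting: shifts, stationary `ℙ`, finite step set, measurable potential,
random walk kernel. -/
def Setting (ℙ : Measure Ω) (T : Zd d → Ω → Ω) (R : Finset (Zd d))
    (V : Ω → Zd d → ℝ) (p : Zd d → ℝ) : Prop :=
  (∀ z : Zd d, Measurable (T z)) ∧ T 0 = id ∧ (∀ x y : Zd d, T (x + y) = T x ∘ T y) ∧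
  (∀ z : Zd d, MeasurePreserving (T z) ℙ ℙ) ∧ 2 ≤ R.card ∧
  (∀ z : Zd d, Measurable fun ω => V ω z) ∧
  (∀ z ∈ R, 0 < p z ∧ p z < 1) ∧ ∑ z ∈ R, p z = 1

/-- `V⁺ ∈ L¹`. -/
def VplusL1 (ℙ : Measure Ω) (V : Ω → Zd d → ℝ) (R : Finset (Zd d)) : Prop :=
  ∀ z ∈ R, Integrable (fun ω => max (V ω z) 0) ℙ

/-- Assumption (i): `V ≥ 0` a.s. on `R₀` and `V ≥ c` a.s. on `R ∖ R₀`. -/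
def AssumptionI (ℙ : Measure Ω) (V : Ω → Zd d → ℝ) (R : Finset (Zd d))
    (U₀ : Set (Fin d → ℝ)) : Prop :=
  (∀ z ∈ R0 R U₀, ∀ᵐ ω ∂ℙ, 0 ≤ V ω z) ∧
  ∃ c : ℝ, ∀ z ∈ R, toR z ∉ U₀ → ∀ᵐ ω ∂ℙ, c ≤ V ω z

end measurable

end RWRP


theorem RWRP.loop_aux {d : ℕ} {ι : Type} (R : Finset (RWRP.Zd d)) (U₀ : Set (Fin d → ℝ))
    (hface : RWRP.IsFace (RWRP.hullU R) U₀) (h0 : (0 : Fin d → ℝ) ∈ U₀)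
    (s : Finset ι) (f : ι → RWRP.Zd d) (hf : ∀ i ∈ s, f i ∈ R) (hsum : ∑ i ∈ s, f i = 0) :
    ∀ i ∈ s, RWRP.toR (f i) ∈ U₀ := by
  classical
  intro i hi
  have hmem : ∀ j ∈ s, RWRP.toR (f j) ∈ RWRP.hullU R := fun j hj =>
    subset_convexHull ℝ _ ⟨f j, hf j hj, rfl⟩
  have hsR : ∑ j ∈ s, RWRP.toR (f j) = 0 := by
    ext a
    have h := congrFun hsum a
    simp only [Finset.sum_apply, Pi.zero_apply] at h
    simp only [Finset.sum_apply, RWRP.toR, Pi.zero_apply]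
    exact_mod_cast h
  rw [← Finset.add_sum_erase s _ hi] at hsR
  rcases (s.erase i).eq_empty_or_nonempty with he | hne
  · rw [he, Finset.sum_empty, add_zero] at hsR
    rw [hsR]; exact h0
  · have hc : (0 : ℝ) < (s.erase i).card := by exact_mod_cast hne.card_pos
    obtain ⟨c, hcdef⟩ : ∃ c : ℝ, c = ((s.erase i).card : ℝ) := ⟨_, rfl⟩
    rw [← hcdef] at hc
    have hη : ∑ j ∈ s.erase i, c⁻¹ • RWRP.toR (f j) ∈ RWRP.hullU R := by
      apply (convex_convexHull ℝ _).sum_mem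
      · intro j _; positivity
      · rw [Finset.sum_const, nsmul_eq_mul, ← hcdef, mul_inv_cancel₀ hc.ne']
      · intro j hj; exact hmem j (Finset.mem_of_mem_erase hj)
    refine (hface.2.2 (t := 1 / (c + 1)) h0 (hmem i hi) hη ⟨by positivity, ?_⟩ ?_).1
    · rw [div_lt_one (by positivity)]; linarith
    · rw [← Finset.smul_sum, smul_smul]
      have : (1 - 1 / (c + 1)) * c⁻¹ = 1 / (c + 1) := by field_simp; ring
      rw [this, ← smul_add, hsR, smul_zero]

open RWRP in
/-- steps of admissible loops lie in `R₀`. -/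
theorem statement6
    {d : ℕ} (R : Finset (Zd d)) (U₀ : Set (Fin d → ℝ))
    (h0 : (0 : Fin d → ℝ) ∈ hullU R) (hface : IsFace (hullU R) U₀)
    (hri : (0 : Fin d → ℝ) ∈ intrinsicInterior ℝ U₀)
    (k : ℕ) (z : Fin k → Zd d) (hz : ∀ i, z i ∈ R) (hsum : ∑ i, z i = 0) :
    (∀ i, toR (z i) ∈ U₀) ∧
    (∀ j : ℕ, 1 ≤ j → j ≤ k - 1 →
      ∀ (m : ℕ) (w : Fin m → Zd d), (∀ ℓ, w ℓ ∈ R) →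
        ((∑ i : Fin k, if (i : ℕ) < j then z i else 0) = ∑ ℓ, w ℓ ∨
          -(∑ i : Fin k, if (i : ℕ) < j then z i else 0) = ∑ ℓ, w ℓ) →
        ∀ ℓ, toR (w ℓ) ∈ U₀) := by
  have hU : (0 : Fin d → ℝ) ∈ U₀ := intrinsicInterior_subset hri
  refine ⟨fun i => RWRP.loop_aux R U₀ hface hU Finset.univ z (fun i _ => hz i) hsum i
    (Finset.mem_univ i), ?_⟩
  intro j _ _ m w hw h ℓ
  have key : ∀ P : Fin k → Prop, (∑ ℓ, w ℓ) + (∑ i with P i, z i) = 0 → toR (w ℓ) ∈ U₀ := by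
    intro P hP
    refine RWRP.loop_aux R U₀ hface hU
      (Finset.disjSum (Finset.univ : Finset (Fin m)) (Finset.univ.filter P))
      (Sum.elim w z) ?_ ?_ (Sum.inl ℓ) (by simp)
    · rintro (a | a) _
      · exact hw a
      · exact hz a
    · rw [Finset.sum_disjSum]; simpa using hP
  have hsplit := Finset.sum_filter_add_sum_filter_not Finset.univ (fun i : Fin k => (i : ℕ) < j) z
  rw [hsum] at hsplit
  rw [← Finset.sum_filter] at h
  rcases h with h | h
  · apply key (fun i => ¬ (i : ℕ) < j)
    rw [← h]; convert hsplit
  · apply key (fun i => (i : ℕ) < j)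
    rw [← h]; convert neg_add_cancel _
end
end

section
/- Assume ℙ{V(ω,z) ≥ 0} = 1 for all z ∈ R₀. Then for ℙ-almost every ω and all x, y, z ∈ ℤ^d with y − x ∈ G₊ and z − y ∈ G₊, one has a(ω,x,z) ≤ a(ω,x,y) + a(ω,y,z) (an inequality in [−∞,∞]). -/
open MeasureTheory Filter Set
open scoped ENNReal NNReal Classical Topology

noncomputable section

section Aux

open RWRP

variable {d : ℕ} {Ω : Type*}

/-- One-step weight. -/
def stepWt (T : Zd d → Ω → Ω) (V : Ω → Zd d → ℝ) (p : Zd d → ℝ) (ω : Ω) (x s : Zd d) : ℝ≥0∞ :=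
  ENNReal.ofReal (p s) * ENNReal.ofReal (Real.exp (-(V (T x ω) s)))

/-- Weight of paths hitting `y` first at time `n+1`. -/
def hitK (T : Zd d → Ω → Ω) (V : Ω → Zd d → ℝ) (p : Zd d → ℝ) (R : Finset (Zd d))
    (ω : Ω) (n : ℕ) (x y : Zd d) : ℝ≥0∞ :=
  ∑ s : Fin (n+1) → {z : Zd d // z ∈ R},
    if firstHit x y (n+1) (stepF (n+1) s) then
      pathW p s * ENNReal.ofReal (Real.exp (-(pathV T V ω x (n+1) (stepF (n+1) s))))
    else 0

/-- Truncated version. -/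
def hN (T : Zd d → Ω → Ω) (V : Ω → Zd d → ℝ) (p : Zd d → ℝ) (R : Finset (Zd d))
    (ω : Ω) (n : ℕ) (x y : Zd d) : ℝ≥0∞ :=
  if y = x then 1 else ∑ i ∈ Finset.range n, hitK T V p R ω i x y

/-- Full version. -/
def hI (T : Zd d → Ω → Ω) (V : Ω → Zd d → ℝ) (p : Zd d → ℝ) (R : Finset (Zd d))
    (ω : Ω) (x y : Zd d) : ℝ≥0∞ :=
  if y = x then 1 else walkK T V p R ω x y

lemma stepF_cons_zero {R : Finset (Zd d)} (n : ℕ) (a : {z : Zd d // z ∈ R})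
    (t : Fin n → {z : Zd d // z ∈ R}) :
    stepF (n+1) (Fin.cons a t : Fin (n+1) → {z : Zd d // z ∈ R}) 0 = a := by
  simp [stepF]

lemma stepF_cons_succ {R : Finset (Zd d)} (n : ℕ) (a : {z : Zd d // z ∈ R})
    (t : Fin n → {z : Zd d // z ∈ R}) (i : ℕ) :
    stepF (n+1) (Fin.cons a t : Fin (n+1) → {z : Zd d // z ∈ R}) (i+1) = stepF n t i := by
  unfold stepF
  by_cases h : i < n
  · have h' : i + 1 < n + 1 := by omega
    rw [dif_pos h, dif_pos h']
    have : (⟨i+1, h'⟩ : Fin (n+1)) = Fin.succ ⟨i, h⟩ := rfl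
    rw [this, Fin.cons_succ]
  · rw [dif_neg h, dif_neg (by omega)]

lemma pos_cons {R : Finset (Zd d)} (n : ℕ) (a : {z : Zd d // z ∈ R})
    (t : Fin n → {z : Zd d // z ∈ R}) (x : Zd d) (k : ℕ) :
    pos x (stepF (n+1) (Fin.cons a t : Fin (n+1) → {z : Zd d // z ∈ R})) (k+1)
      = pos (x + (a : Zd d)) (stepF n t) k := by
  unfold pos
  rw [Finset.sum_range_succ', stepF_cons_zero]
  simp only [stepF_cons_succ]
  abel

lemma pathV_cons (T : Zd d → Ω → Ω) (V : Ω → Zd d → ℝ) (ω : Ω)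
    {R : Finset (Zd d)} (n : ℕ) (a : {z : Zd d // z ∈ R})
    (t : Fin n → {z : Zd d // z ∈ R}) (x : Zd d) :
    pathV T V ω x (n+1) (stepF (n+1) (Fin.cons a t : Fin (n+1) → {z : Zd d // z ∈ R}))
      = V (T x ω) a + pathV T V ω (x + (a : Zd d)) n (stepF n t) := by
  unfold pathV
  rw [Finset.sum_range_succ', stepF_cons_zero]
  simp only [stepF_cons_succ, pos_cons]
  rw [add_comm]
  simp [pos]

lemma firstHit_cons {R : Finset (Zd d)} (n : ℕ) (a : {z : Zd d // z ∈ R})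
    (t : Fin (n+1) → {z : Zd d // z ∈ R}) (x y : Zd d) :
    firstHit x y (n+2) (stepF (n+2) (Fin.cons a t : Fin (n+2) → {z : Zd d // z ∈ R}))
      ↔ y ≠ x + (a : Zd d) ∧ firstHit (x + (a : Zd d)) y (n+1) (stepF (n+1) t) := by
  unfold firstHit
  rw [pos_cons]
  constructor
  · rintro ⟨h1, h2⟩
    refine ⟨?_, h1, ?_⟩
    · have := h2 1 (by simp)
      intro h
      apply this
      rw [pos_cons (n+1) a t x 0]
      simp [pos, h]
    · intro k hk
      have := h2 (k+1) (by simp at hk ⊢; omega)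
      rwa [pos_cons] at this
  · rintro ⟨h0, h1, h2⟩
    refine ⟨h1, ?_⟩
    intro k hk
    obtain _ | k := k
    · simp at hk
    · rw [pos_cons]
      obtain _ | k := k
      · simp only [pos, Finset.range_zero, Finset.sum_empty, add_zero]
        exact fun h => h0 h.symm
      · exact h2 _ (by simp at hk ⊢; omega)

lemma pathTerm_cons (T : Zd d → Ω → Ω) (V : Ω → Zd d → ℝ) (p : Zd d → ℝ) (ω : Ω)
    {R : Finset (Zd d)} (n : ℕ) (a : {z : Zd d // z ∈ R})
    (t : Fin n → {z : Zd d // z ∈ R}) (x : Zd d) :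
    pathW p (Fin.cons a t : Fin (n+1) → {z : Zd d // z ∈ R}) *
      ENNReal.ofReal (Real.exp (-(pathV T V ω x (n+1)
        (stepF (n+1) (Fin.cons a t : Fin (n+1) → {z : Zd d // z ∈ R})))))
    = stepWt T V p ω x a *
      (pathW p t * ENNReal.ofReal (Real.exp (-(pathV T V ω (x + (a : Zd d)) n (stepF n t))))) := by
  rw [pathV_cons, neg_add, Real.exp_add, ENNReal.ofReal_mul (Real.exp_pos _).le]
  unfold pathW stepWt
  rw [Fin.prod_univ_succ]
  simp only [Fin.cons_zero, Fin.cons_succ]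
  ring

variable (T : Zd d → Ω → Ω) (V : Ω → Zd d → ℝ) (p : Zd d → ℝ) (R : Finset (Zd d)) (ω : Ω)

lemma hitK_succ (n : ℕ) (x y : Zd d) :
    hitK T V p R ω (n+1) x y = ∑ a : {z : Zd d // z ∈ R},
      stepWt T V p ω x a * (if y = x + (a : Zd d) then 0 else hitK T V p R ω n (x + (a : Zd d)) y) := by
  conv_lhs => unfold hitK
  rw [← (Fin.consEquiv (fun _ : Fin (n+2) => {z : Zd d // z ∈ R})).sum_comp,
    Fintype.sum_prod_type]
  refine Finset.sum_congr rfl fun a _ => ?_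
  change (∑ t : Fin (n+1) → {z : Zd d // z ∈ R},
    if firstHit x y (n+1+1) (stepF (n+1+1) (Fin.cons a t : Fin (n+1+1) → {z : Zd d // z ∈ R})) then
      pathW p (Fin.cons a t : Fin (n+1+1) → {z : Zd d // z ∈ R}) *
        ENNReal.ofReal (Real.exp (-(pathV T V ω x (n+1+1)
          (stepF (n+1+1) (Fin.cons a t : Fin (n+1+1) → {z : Zd d // z ∈ R})))))
    else 0) = _
  by_cases h : y = x + (a : Zd d)
  · rw [if_pos h, mul_zero]
    refine Finset.sum_eq_zero fun t _ => ?_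
    rw [if_neg]
    rw [firstHit_cons]
    exact fun h' => h'.1 h
  · rw [if_neg h]
    unfold hitK
    rw [Finset.mul_sum]
    refine Finset.sum_congr rfl fun t _ => ?_
    rw [pathTerm_cons]
    by_cases h2 : firstHit (x + (a : Zd d)) y (n+1) (stepF (n+1) t)
    · rw [if_pos h2, if_pos ((firstHit_cons n a t x y).2 ⟨h, h2⟩)]
    · rw [if_neg h2, if_neg (fun h3 => h2 ((firstHit_cons n a t x y).1 h3).2), mul_zero]

lemma hitK_zero (x y : Zd d) :
    hitK T V p R ω 0 x y = ∑ a : {z : Zd d // z ∈ R},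
      stepWt T V p ω x a * (if y = x + (a : Zd d) then 1 else 0) := by
  unfold hitK
  rw [← (Fin.consEquiv (fun _ : Fin (0+1) => {z : Zd d // z ∈ R})).sum_comp,
    Fintype.sum_prod_type]
  refine Finset.sum_congr rfl fun a _ => ?_
  change (∑ t : Fin (0) → {z : Zd d // z ∈ R},
    if firstHit x y (0+1) (stepF (0+1) (Fin.cons a t : Fin (0+1) → {z : Zd d // z ∈ R})) then
      pathW p (Fin.cons a t : Fin (0+1) → {z : Zd d // z ∈ R}) *
        ENNReal.ofReal (Real.exp (-(pathV T V ω x (0+1)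
          (stepF (0+1) (Fin.cons a t : Fin (0+1) → {z : Zd d // z ∈ R})))))
    else 0) = _
  rw [Fintype.sum_unique]
  rw [pathTerm_cons]
  have : firstHit x y (0+1) (stepF (0+1) (Fin.cons a default : Fin (0+1) → {z : Zd d // z ∈ R}))
      ↔ y = x + (a : Zd d) := by
    unfold firstHit
    rw [pos_cons]
    simp only [pos, Finset.range_zero, Finset.sum_empty, add_zero]
    constructor
    · exact fun h => h.1.symm
    · refine fun h => ⟨h.symm, fun k hk => ?_⟩
      simp at hk
      omega
  by_cases h : y = x + (a : Zd d)
  · rw [if_pos h, if_pos (this.2 h)]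
    simp [pathW, pathV]
  · rw [if_neg h, if_neg (fun h' => h (this.1 h')), mul_zero]

lemma hN_succ (n : ℕ) {x y : Zd d} (h : y ≠ x) :
    hN T V p R ω (n+1) x y = ∑ a : {z : Zd d // z ∈ R},
      stepWt T V p ω x a * hN T V p R ω n (x + (a : Zd d)) y := by
  conv_lhs => unfold hN
  rw [if_neg h, Finset.sum_range_succ', hitK_zero]
  simp only [hitK_succ]
  rw [Finset.sum_comm, ← Finset.sum_add_distrib]
  refine Finset.sum_congr rfl fun a _ => ?_
  rw [← Finset.mul_sum, ← mul_add]
  congr 1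
  unfold hN
  by_cases h : y = x + (a : Zd d) <;> simp [h]

lemma hI_eq_iSup (x y : Zd d) : hI T V p R ω x y = ⨆ n, hN T V p R ω n x y := by
  unfold hI hN
  by_cases h : y = x
  · simp [h]
  · simp only [if_neg h]
    exact ENNReal.tsum_eq_iSup_nat

lemma hN_mono (x y : Zd d) : Monotone fun n => hN T V p R ω n x y := by
  intro m n hmn
  simp only [hN]
  split_ifs
  · exact le_rfl
  · exact Finset.sum_le_sum_of_subset (Finset.range_mono hmn)

lemma hI_step {x y : Zd d} (h : y ≠ x) :
    hI T V p R ω x y = ∑ a : {z : Zd d // z ∈ R},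
      stepWt T V p ω x a * hI T V p R ω (x + (a : Zd d)) y := by
  rw [hI_eq_iSup, ← (hN_mono T V p R ω x y).iSup_nat_add 1]
  simp only [hN_succ T V p R ω _ h, hI_eq_iSup, ENNReal.mul_iSup]
  rw [ENNReal.finsetSum_iSup_of_monotone]
  intro a m n hmn
  exact mul_le_mul_right (hN_mono T V p R ω _ _ hmn) _

lemma Gp_zero : (0 : Zd d) ∈ Gp R := ⟨0, by simp⟩

lemma Gp_add {u v : Zd d} (hu : u ∈ Gp R) (hv : v ∈ Gp R) : u + v ∈ Gp R := by
  obtain ⟨b, rfl⟩ := hu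
  obtain ⟨c, rfl⟩ := hv
  exact ⟨b + c, by simp [add_smul, Finset.sum_add_distrib]⟩

lemma Gp_mem {u : Zd d} (hu : u ∈ R) : u ∈ Gp R :=
  ⟨fun z => if z = u then 1 else 0, by simp [hu]⟩

lemma Gp_of_hN (n : ℕ) : ∀ x y : Zd d, hN T V p R ω n x y ≠ 0 → y - x ∈ Gp R := by
  induction n with
  | zero =>
    intro x y h
    by_cases hxy : y = x
    · rw [hxy, sub_self]; exact Gp_zero R
    · simp [hN, hxy] at h
  | succ n ih =>
    intro x y h
    by_cases hxy : y = x
    · rw [hxy, sub_self]; exact Gp_zero R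
    · rw [hN_succ T V p R ω n hxy] at h
      obtain ⟨a, _, ha⟩ := Finset.exists_ne_zero_of_sum_ne_zero h
      have := Gp_add R (ih _ _ (right_ne_zero_of_mul ha)) (Gp_mem R a.2)
      convert this using 1
      abel

lemma Gp_of_hI {x y : Zd d} (h : hI T V p R ω x y ≠ 0) : y - x ∈ Gp R := by
  rw [hI_eq_iSup] at h
  by_contra hc
  apply h
  simp only [ENNReal.iSup_eq_zero]
  intro n
  by_contra h'
  exact hc (Gp_of_hN T V p R ω n x y h')

lemma hI_ne_zero (hp : ∀ z ∈ R, 0 < p z) {x y : Zd d} (h : y - x ∈ Gp R) :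
    hI T V p R ω x y ≠ 0 := by
  have hc : y - x ∈ AddSubmonoid.closure (R : Set (Zd d)) := by
    obtain ⟨b, hb⟩ := h
    rw [hb]
    exact sum_mem fun z hz => nsmul_mem (AddSubmonoid.subset_closure hz) _
  have key : ∀ v ∈ AddSubmonoid.closure (R : Set (Zd d)), ∀ x, hI T V p R ω x (x + v) ≠ 0 := by
    intro v hv
    induction hv using AddSubmonoid.closure_induction_left with
    | zero => intro x; simp [hI]
    | add_left s hs v hv ih =>
      intro x
      by_cases h0 : x + (s + v) = x
      · simp [hI, h0]
      · rw [hI_step T V p R ω h0]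
        intro hz
        have h1 := (Finset.sum_eq_zero_iff.1 hz) ⟨s, hs⟩ (Finset.mem_univ _)
        rw [mul_eq_zero] at h1
        rcases h1 with h1 | h1
        · simp only [stepWt, mul_eq_zero, ENNReal.ofReal_eq_zero] at h1
          rcases h1 with h1 | h1
          · exact absurd (hp s hs) (not_lt.2 h1)
          · exact absurd (Real.exp_pos _) (not_lt.2 h1)
        · apply ih (x + s)
          rw [add_assoc]
          exact h1
  have := key _ hc x
  rwa [add_sub_cancel] at this

lemma toR_sum {ι : Type*} (s : Finset ι) (f : ι → Zd d) : toR (∑ i ∈ s, f i) = ∑ i ∈ s, toR (f i) := by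
  funext j
  simp [toR, Finset.sum_apply]

lemma mem_zeroFace (U₀ : Set (Fin d → ℝ)) (hU₀ : IsZeroFace R U₀) {s : Zd d} (hs : s ∈ R)
    (hn : -s ∈ Gp R) : toR s ∈ U₀ := by
  obtain ⟨b, hb⟩ := hn
  have hsU : toR s ∈ hullU R := subset_convexHull _ _ ⟨s, hs, rfl⟩
  set N : ℝ := ∑ z ∈ R, (b z : ℝ) with hN
  have hb' : - toR s = ∑ z ∈ R, (b z : ℝ) • toR z := by
    have : toR (-s) = toR (∑ z ∈ R, b z • z) := by rw [hb]
    rw [toR_sum] at this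
    have e1 : toR (-s) = - toR s := by funext j; simp [toR]
    rw [← e1, this]
    refine Finset.sum_congr rfl fun z _ => ?_
    funext j; simp [toR]
  have hN0 : 0 ≤ N := Finset.sum_nonneg fun _ _ => Nat.cast_nonneg _
  rcases hN0.eq_or_lt with h0 | h0
  · have hz : ∀ z ∈ R, (b z : ℝ) = 0 :=
      (Finset.sum_eq_zero_iff_of_nonneg fun _ _ => Nat.cast_nonneg _).1 h0.symm
    have : toR s = 0 := by
      rw [← neg_eq_zero, hb']
      exact Finset.sum_eq_zero fun z hz' => by rw [hz z hz', zero_smul]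
    rw [this] at hsU ⊢
    rcases hU₀ with ⟨_, _, h⟩ | ⟨h, _⟩
    · exact intrinsicInterior_subset h
    · exact absurd hsU h
  · set η := R.centerMass (fun z => (b z : ℝ)) toR with hη
    have hηU : η ∈ hullU R := Finset.centerMass_mem_convexHull _
      (fun _ _ => Nat.cast_nonneg _) h0 (fun z hz => ⟨z, hz, rfl⟩)
    have hη' : N • η = - toR s := by
      rw [hη, Finset.centerMass, ← hN, smul_smul, mul_inv_cancel₀ h0.ne', one_smul, hb']
    have hcomb : (0 : Fin d → ℝ) = (1 + N)⁻¹ • toR s + (1 - (1 + N)⁻¹) • η := by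
      have : (1 - (1 + N)⁻¹) = (1 + N)⁻¹ * N := by field_simp; ring
      rw [this, mul_smul, hη']; simp
    have ht : (1 + N)⁻¹ ∈ Set.Ioo (0:ℝ) 1 := ⟨by positivity, inv_lt_one_of_one_lt₀ (by linarith)⟩
    rcases hU₀ with ⟨_, hF, h⟩ | ⟨h, _⟩
    · exact (hF.2.2 (intrinsicInterior_subset h) hsU hηU ht hcomb).1
    · exfalso
      apply h
      rw [hcomb]
      exact (convex_convexHull ℝ _) hsU hηU ht.1.le (by linarith [ht.2]) (by ring)

lemma hN_le_one (hp : ∀ z ∈ R, 0 < p z) (hp1 : ∑ z ∈ R, p z = 1)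
    (hV : ∀ s ∈ R, -s ∈ Gp R → ∀ x, 0 ≤ V (T x ω) s) (n : ℕ) :
    ∀ x y : Zd d, x - y ∈ Gp R → hN T V p R ω n x y ≤ 1 := by
  induction n with
  | zero => intro x y _; unfold hN; split_ifs <;> simp
  | succ n ih =>
    intro x y hxy
    by_cases h : y = x
    · simp [hN, h]
    rw [hN_succ T V p R ω n h]
    calc _ ≤ ∑ a : {z : Zd d // z ∈ R}, ENNReal.ofReal (p a) := by
          refine Finset.sum_le_sum fun a _ => ?_
          by_cases h0 : hN T V p R ω n (x + (a : Zd d)) y = 0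
          · rw [h0, mul_zero]; exact zero_le
          have h1 := Gp_of_hN T V p R ω n _ _ h0
          have h2 : x + (a : Zd d) - y ∈ Gp R := by
            have := Gp_add R hxy (Gp_mem R a.2)
            convert this using 1
            abel
          have h3 : -(a : Zd d) ∈ Gp R := by
            have := Gp_add R h1 hxy
            convert this using 1
            abel
          have h4 : stepWt T V p ω x a ≤ ENNReal.ofReal (p a) := by
            unfold stepWt
            refine mul_le_of_le_one_right' ?_
            rw [ENNReal.ofReal_le_one, Real.exp_le_one_iff]
            linarith [hV a a.2 h3 x]
          calc _ ≤ ENNReal.ofReal (p a) * 1 := mul_le_mul' h4 (ih _ _ h2)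
            _ = _ := mul_one _
      _ = 1 := by
          rw [← ENNReal.ofReal_sum_of_nonneg (fun (a : {z : Zd d // z ∈ R}) _ => (hp a.1 a.2).le),
            Finset.sum_coe_sort R p, hp1, ENNReal.ofReal_one]

lemma hI_mul_le_one (hp : ∀ z ∈ R, 0 < p z) (hp1 : ∑ z ∈ R, p z = 1)
    (hV : ∀ s ∈ R, -s ∈ Gp R → ∀ x, 0 ≤ V (T x ω) s) (x y : Zd d) :
    hI T V p R ω x y * hI T V p R ω y x ≤ 1 := by
  by_cases h1 : hI T V p R ω x y = 0
  · simp [h1]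
  by_cases h2 : hI T V p R ω y x = 0
  · simp [h2]
  have g1 := Gp_of_hI T V p R ω h1
  have g2 := Gp_of_hI T V p R ω h2
  refine mul_le_one' ?_ ?_
  · rw [hI_eq_iSup]
    exact iSup_le fun n => hN_le_one T V p R ω hp hp1 hV n _ _ g2
  · rw [hI_eq_iSup]
    exact iSup_le fun n => hN_le_one T V p R ω hp hp1 hV n _ _ g1

lemma hI_supermul (hp : ∀ z ∈ R, 0 < p z) (hp1 : ∑ z ∈ R, p z = 1)
    (hV : ∀ s ∈ R, -s ∈ Gp R → ∀ x, 0 ≤ V (T x ω) s) (x y z : Zd d) :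
    hI T V p R ω x y * hI T V p R ω y z ≤ hI T V p R ω x z := by
  have key : ∀ n x, hN T V p R ω n x y * hI T V p R ω y z ≤ hI T V p R ω x z := by
    intro n
    induction n with
    | zero =>
      intro x
      by_cases h : y = x
      · simp [hN, h]
      · simp [hN, h]
    | succ n ih =>
      intro x
      by_cases h : y = x
      · simp [hN, h]
      by_cases hz : z = x
      · subst hz
        calc _ ≤ hI T V p R ω z y * hI T V p R ω y z := by
              refine mul_le_mul' ?_ le_rfl
              rw [hI_eq_iSup]
              exact le_iSup (fun n => hN T V p R ω n z y) (n+1)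
          _ ≤ 1 := hI_mul_le_one T V p R ω hp hp1 hV _ _
          _ = _ := by simp [hI]
      · rw [hN_succ T V p R ω n h, hI_step T V p R ω hz, Finset.sum_mul]
        refine Finset.sum_le_sum fun a _ => ?_
        rw [mul_assoc]
        exact mul_le_mul' le_rfl (ih _)
  rw [hI_eq_iSup T V p R ω x y, ENNReal.iSup_mul]
  exact iSup_le fun n => key n x

lemma aE_eq (x y : Zd d) : aE T V p R ω x y = - ENNReal.log (hI T V p R ω x y) := by
  unfold aE hI
  split_ifs <;> simp

end Aux



open RWRP in
/-- subadditivity of `a`, as an inequality in `[-∞,∞]`. -/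
theorem statement7
    {d : ℕ} {Ω : Type*} [MeasurableSpace Ω]
    (ℙ : Measure Ω) [IsProbabilityMeasure ℙ]
    (T : Zd d → Ω → Ω) (R : Finset (Zd d)) (V : Ω → Zd d → ℝ) (p : Zd d → ℝ)
    (hset : Setting ℙ T R V p)
    (U₀ : Set (Fin d → ℝ)) (hU₀ : IsZeroFace R U₀)
    (hV0 : ∀ z ∈ R0 R U₀, ∀ᵐ ω ∂ℙ, 0 ≤ V ω z) :
    ∀ᵐ ω ∂ℙ, ∀ x y z : Zd d, y - x ∈ Gp R → z - y ∈ Gp R →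
      aE T V p R ω x z ≤ aE T V p R ω x y + aE T V p R ω y z := by
  obtain ⟨_, _, _, hT, _, _, hp, hp1⟩ := hset
  have hpp : ∀ z ∈ R, 0 < p z := fun z hz => (hp z hz).1
  have hae : ∀ᵐ ω ∂ℙ, ∀ s : Zd d, ∀ x : Zd d, s ∈ R → -s ∈ Gp R → 0 ≤ V (T x ω) s := by
    rw [ae_all_iff]; intro s
    rw [ae_all_iff]; intro x
    by_cases h : s ∈ R ∧ -s ∈ Gp R
    · have h0 := hV0 s ⟨h.1, mem_zeroFace R U₀ hU₀ h.1 h.2⟩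
      filter_upwards [(hT x).quasiMeasurePreserving.ae h0] with ω hω _ _
      exact hω
    · exact Filter.Eventually.of_forall fun ω h1 h2 => absurd ⟨h1, h2⟩ h
  filter_upwards [hae] with ω hω x y z hxy hyz
  have h1 := hI_ne_zero T V p R ω hpp hxy
  have h2 := hI_ne_zero T V p R ω hpp hyz
  have h3 := hI_supermul T V p R ω hpp hp1 (fun s hs hn x => hω s x hs hn) x y z
  have h1' : ENNReal.log (hI T V p R ω x y) ≠ ⊥ := fun h => h1 (ENNReal.log_eq_bot_iff.1 h)
  have h2' : ENNReal.log (hI T V p R ω y z) ≠ ⊥ := fun h => h2 (ENNReal.log_eq_bot_iff.1 h)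
  rw [aE_eq, aE_eq, aE_eq, ← sub_eq_add_neg, ← EReal.neg_add (Or.inl h1') (Or.inr h2'),
    ← ENNReal.log_mul_add, EReal.neg_le_neg_iff]
  exact ENNReal.log_le_log h3
end
end

section
/- Let R be a finite subset of ℤ^d with at least two points, C₊ = {Σ_{z∈R} b_z z : b_z ∈ ℝ₊} its real cone and G₊ = {Σ_{z∈R} b_z z : b_z ∈ ℤ₊} its integer semigroup. Then there exist functions γ_z : C₊ → ℝ₊ (one for each z ∈ R) and a finite positive constant C such that Σ_{z∈R} γ_z(ξ) z = ξ and γ_z(ξ) ≤ C|ξ|₁ for all ξ ∈ C₊ and all z ∈ R; and moreover, if ξ ∈ G₊ then γ_z(ξ) ∈ ℤ₊ for all z ∈ R. -/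
open MeasureTheory Filter Set
open scoped ENNReal NNReal Classical Topology

noncomputable section

theorem hilb_aux {ι κ G : Type*} [Fintype ι] [Fintype κ] [AddCommGroup G]
    (F : (ι → ℕ) →+ G) (H : (κ → ℕ) →+ G) :
    ∃ C : ℕ, ∀ p : (ι → ℕ) × (κ → ℕ), F p.1 = H p.2 →
      ∃ b : ι → ℕ, F b = H p.2 ∧ ∑ i, b i ≤ C * ∑ k, p.2 k := by
  let P : (ι → ℕ) × (κ → ℕ) → Prop := fun p => F p.1 = H p.2 ∧ p ≠ 0
  have hfin : {m | Minimal P m}.Finite :=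
    WellQuasiOrderedLE.finite_of_isAntichain (setOfPred_minimal_antichain P)
  obtain ⟨C, hC⟩ := (hfin.image (fun m => ∑ i, m.1 i)).bddAbove
  refine ⟨C, fun p => ?_⟩
  induction p using WellFoundedLT.induction with
  | _ p ih =>
  intro hp
  by_cases h0 : p = 0
  · subst h0
    exact ⟨0, by simp, by simp⟩
  obtain ⟨m, hmp, hm⟩ := exists_minimal_le_of_wellFoundedLT P p ⟨hp, h0⟩
  have hmC : ∑ i, m.1 i ≤ C := hC ⟨m, hm, rfl⟩
  obtain ⟨hm1, hm0⟩ := hm.1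
  obtain ⟨q, rfl⟩ := le_iff_exists_add.1 hmp
  have hq : F q.1 = H q.2 := by
    simp only [Prod.fst_add, Prod.snd_add, map_add, hm1] at hp
    exact add_left_cancel hp
  have hlt : q < m + q := by
    refine lt_of_le_of_ne le_add_self fun h => hm0 ?_
    simpa using h.symm
  obtain ⟨b, hb, hbC⟩ := ih q hlt hq
  by_cases h2 : m.2 = 0
  · exact ⟨b, by simpa [h2] using hb, by simpa [h2] using hbC⟩
  · have h1 : 1 ≤ ∑ k, m.2 k := by
      by_contra hcon
      apply h2
      have : ∑ k, m.2 k = 0 := by omega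
      rw [Finset.sum_eq_zero_iff] at this
      ext k
      exact this k (Finset.mem_univ k)
    refine ⟨m.1 + b, by simp [hm1, hb], ?_⟩
    simp only [Prod.snd_add, Pi.add_apply, Finset.sum_add_distrib]
    nlinarith

open RWRP in
theorem int_aux {d : ℕ} (R : Finset (Zd d)) : ∃ C : ℝ, 0 < C ∧ ∀ x ∈ Gp R, ∃ b : Zd d → ℕ,
    ∑ z ∈ R, b z • z = x ∧ ∀ z, (b z : ℝ) ≤ C * n1 (toR x) := by
  let F : (R → ℕ) →+ Zd d :=
    { toFun := fun b => ∑ z, b z • (z : Zd d)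
      map_zero' := by simp
      map_add' := fun a b => by simp [add_smul, Finset.sum_add_distrib] }
  let H : (Fin d ⊕ Fin d → ℕ) →+ Zd d :=
    { toFun := fun c i => (c (Sum.inl i) : ℤ) - c (Sum.inr i)
      map_zero' := by ext; simp
      map_add' := fun a b => by ext; simp; ring }
  obtain ⟨C, hC⟩ := hilb_aux F H
  refine ⟨C + 1, by positivity, ?_⟩
  rintro x ⟨b, hb⟩
  let c : Fin d ⊕ Fin d → ℕ := Sum.elim (fun i => (x i).toNat) (fun i => (-(x i)).toNat)
  have hH : H c = x := by
    ext i
    simp only [H, c, AddMonoidHom.coe_mk, ZeroHom.coe_mk, Sum.elim_inl, Sum.elim_inr]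
    omega
  have hF : F (fun z => b z) = x := by
    rw [hb]
    exact Finset.sum_coe_sort R (fun z => b z • z)
  obtain ⟨b', hb', hbC⟩ := hC (fun z => b z, c) (by simp only [hH, hF])
  have hc : ((∑ k, c k : ℕ) : ℝ) = n1 (toR x) := by
    simp only [Fintype.sum_sum_type, c, Sum.elim_inl, Sum.elim_inr, n1, toR]
    rw [← Finset.sum_add_distrib]
    push_cast
    refine Finset.sum_congr rfl fun i _ => ?_
    have : ((x i).toNat : ℤ) + ((-(x i)).toNat : ℤ) = |x i| := by
      rcases abs_cases (x i) with h | h <;> omega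
    exact_mod_cast this
  have hn : 0 ≤ n1 (toR x) := Finset.sum_nonneg fun i _ => abs_nonneg _
  refine ⟨fun z => if h : z ∈ R then b' ⟨z, h⟩ else 0, ?_, fun z => ?_⟩
  · simp only [hH] at hb'
    rw [← hb', ← Finset.sum_coe_sort R]
    simp [F]
  · dsimp only
    split_ifs with h
    · have h1 : b' ⟨z, h⟩ ≤ ∑ i, b' i :=
        Finset.single_le_sum (f := b') (fun i _ => Nat.zero_le _) (Finset.mem_univ _)
      have h2 : ((b' ⟨z, h⟩ : ℕ) : ℝ) ≤ C * n1 (toR x) := by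
        rw [← hc]
        exact_mod_cast h1.trans hbC
      linarith
    · simp only [Nat.cast_zero]
      positivity

open RWRP in
theorem toR_sum_aux {d : ℕ} (R : Finset (Zd d)) (b : Zd d → ℕ) :
    toR (∑ z ∈ R, b z • z) = ∑ z ∈ R, (b z : ℝ) • toR z := by
  ext i
  simp [toR, Finset.sum_apply]

open RWRP in
theorem real_aux {d : ℕ} (R : Finset (Zd d)) (C : ℝ) (hC0 : 0 < C)
    (hC : ∀ x ∈ Gp R, ∃ b : Zd d → ℕ,
      ∑ z ∈ R, b z • z = x ∧ ∀ z, (b z : ℝ) ≤ C * n1 (toR x))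
    (ξ : Fin d → ℝ) (hξ : ξ ∈ Cp R) :
    ∃ g : Zd d → ℝ, (∀ z, 0 ≤ g z) ∧ (∑ z ∈ R, g z • toR z = ξ) ∧ ∀ z, g z ≤ C * n1 ξ := by
  obtain ⟨a, ha, rfl⟩ := hξ
  have h := fun n : ℕ => hC (∑ z ∈ R, ⌊a z * n⌋₊ • z) ⟨fun z => ⌊a z * n⌋₊, rfl⟩
  choose b hb hbC using h
  set ξ := ∑ z ∈ R, a z • toR z with hξ
  let ξn : ℕ → Fin d → ℝ := fun n => ∑ z ∈ R, ((⌊a z * n⌋₊ : ℝ) / n) • toR z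
  have hlim : Tendsto ξn atTop (𝓝 ξ) := by
    refine tendsto_finset_sum _ fun z _ => ?_
    refine Tendsto.smul_const ?_ _
    exact (tendsto_nat_floor_mul_div_atTop (ha z)).comp tendsto_natCast_atTop_atTop
  have hn1 : Continuous (n1 : (Fin d → ℝ) → ℝ) := by
    unfold n1
    fun_prop
  have hlim1 : Tendsto (fun n => C * n1 (ξn n)) atTop (𝓝 (C * n1 ξ)) :=
    ((hn1.tendsto ξ).comp hlim).const_mul C
  let g : ℕ → Zd d → ℝ := fun n z => (b n z : ℝ) / n
  have hξn : ∀ n : ℕ, ξn n = (n : ℝ)⁻¹ • toR (∑ z ∈ R, ⌊a z * n⌋₊ • z) := by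
    intro n
    rw [toR_sum_aux, Finset.smul_sum]
    refine Finset.sum_congr rfl fun z _ => ?_
    rw [smul_smul, div_eq_inv_mul]
  have hg1 : ∀ n, ∑ z ∈ R, g n z • toR z = ξn n := by
    intro n
    rw [hξn, ← hb, toR_sum_aux, Finset.smul_sum]
    refine Finset.sum_congr rfl fun z _ => ?_
    rw [smul_smul, ← div_eq_inv_mul]
  have hg2 : ∀ n z, g n z ≤ C * n1 (ξn n) := by
    intro n z
    have h1 : n1 (ξn n) = (n : ℝ)⁻¹ * n1 (toR (∑ z ∈ R, ⌊a z * n⌋₊ • z)) := by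
      rw [hξn]
      simp [n1, abs_mul, Finset.mul_sum]
    rw [h1]
    have := mul_le_mul_of_nonneg_left (hbC n z) (inv_nonneg.2 (Nat.cast_nonneg (α := ℝ) n))
    simp only [g, div_eq_inv_mul]
    linarith
  have hg0 : ∀ n z, 0 ≤ g n z := fun n z => by positivity
  obtain ⟨K, hK⟩ := hlim1.bddAbove_range
  have hcpt : IsCompact (Set.univ.pi fun _ : Zd d => Set.Icc (0 : ℝ) K) :=
    isCompact_univ_pi fun _ => isCompact_Icc
  obtain ⟨g', -, φ, hφ, hlg⟩ := hcpt.tendsto_subseq (x := g)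
    (fun n z _ => ⟨hg0 n z, (hg2 n z).trans (hK ⟨n, rfl⟩)⟩)
  have hz : ∀ z, Tendsto (fun n => g (φ n) z) atTop (𝓝 (g' z)) := fun z =>
    (tendsto_pi_nhds.1 hlg) z
  refine ⟨g', fun z => ge_of_tendsto' (hz z) fun n => hg0 _ z, ?_, fun z => ?_⟩
  · refine tendsto_nhds_unique (f := fun n => ∑ z ∈ R, g (φ n) z • toR z)
      (tendsto_finset_sum _ fun z _ => (hz z).smul_const _) ?_
    simp only [hg1]
    exact hlim.comp hφ.tendsto_atTop
  · exact le_of_tendsto_of_tendsto' (hz z) (hlim1.comp hφ.tendsto_atTop) fun n => hg2 _ z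

open RWRP in
/-- the coefficient lemma. -/
theorem statement8
    {d : ℕ} (R : Finset (Zd d)) (hR : 2 ≤ R.card) :
    ∃ (γ : (Fin d → ℝ) → Zd d → ℝ) (C : ℝ), 0 < C ∧
      (∀ ξ ∈ Cp R, (∀ z, 0 ≤ γ ξ z) ∧ (∑ z ∈ R, γ ξ z • toR z = ξ) ∧
        ∀ z ∈ R, γ ξ z ≤ C * n1 ξ) ∧
      (∀ x ∈ Gp R, ∀ z, ∃ m : ℕ, γ (toR x) z = (m : ℝ)) := by

  obtain ⟨C, hC0, hC⟩ := int_aux R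
  have key : ∀ ξ : Fin d → ℝ, ∃ g : Zd d → ℝ,
      (ξ ∈ Cp R → (∀ z, 0 ≤ g z) ∧ (∑ z ∈ R, g z • toR z = ξ) ∧ ∀ z ∈ R, g z ≤ C * n1 ξ) ∧
      (∀ x ∈ Gp R, toR x = ξ → ∀ z, ∃ m : ℕ, g z = (m : ℝ)) := by
    intro ξ
    by_cases h : ∃ x ∈ Gp R, toR x = ξ
    · obtain ⟨x, hx, rfl⟩ := h
      obtain ⟨b, hb, hbC⟩ := hC x hx
      refine ⟨fun z => b z, fun _ => ⟨fun z => Nat.cast_nonneg _, ?_, fun z _ => hbC z⟩,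
        fun _ _ _ z => ⟨b z, rfl⟩⟩
      rw [← toR_sum_aux, hb]
    · by_cases h' : ξ ∈ Cp R
      · obtain ⟨g, h1, h2, h3⟩ := real_aux R C hC0 hC ξ h'
        exact ⟨g, fun _ => ⟨h1, h2, fun z _ => h3 z⟩, fun x hx hxe => (h ⟨x, hx, hxe⟩).elim⟩
      · exact ⟨0, fun hh => (h' hh).elim, fun x hx hxe => (h ⟨x, hx, hxe⟩).elim⟩
  choose γ h1 h2 using key
  exact ⟨γ, C, hC0, h1, fun x hx => h2 _ x hx rfl⟩
end
end

section
/- Let Γ be a Polish space, Ω = Γ^{ℤ^d} with product topology and Borel σ-algebra, shifts (T_xω)_y = ω_{x+y}, and ℙ a shift-invariant probability measure with a finite range of dependence (there exists M ≥ 0 such that for any A, B ⊂ ℤ^d with |x−y|₁ > M for all x ∈ A, y ∈ B, the collections {ω_x : x ∈ A} and {ω_x : x ∈ B} are independent under ℙ). Assume 0 ∉ U, that V is local (there exists L ≥ 0 such that for all z ∈ R, V(ω,z) is measurable with respect to σ({ω_x : |x|₁ ≤ L})), and that V⁻ = max(−V,0) satisfies E[V⁻(ω,z)^p] < ∞ for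 all z ∈ R, for some p > d. Then there exists a deterministic finite positive constant C such that, ℙ-almost surely, for all x ∈ G₊: liminf_{n→∞} a(0,nx)/n ≥ −C|x|₁. -/
open MeasureTheory Filter Set
open scoped ENNReal NNReal Classical Topology

noncomputable section

namespace RWRP

lemma n1Z_nonneg {d : ℕ} (x : Zd d) : 0 ≤ n1Z x := by
  unfold n1Z n1
  exact Finset.sum_nonneg fun _ _ => abs_nonneg _

lemma n1Z_add_le {d : ℕ} (x y : Zd d) : n1Z (x + y) ≤ n1Z x + n1Z y := by
  unfold n1Z n1 toR
  rw [← Finset.sum_add_distrib]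
  refine Finset.sum_le_sum fun i _ => ?_
  simpa using abs_add_le (x i : ℝ) (y i : ℝ)

lemma n1Z_sum_le {d : ℕ} (f : ℕ → Zd d) (n : ℕ) (K : ℝ) (h : ∀ i < n, n1Z (f i) ≤ K) :
    n1Z (∑ i ∈ Finset.range n, f i) ≤ n * K := by
  induction n with
  | zero => simp [n1Z, n1, toR]
  | succ n ih =>
    rw [Finset.sum_range_succ]
    have := ih fun i hi => h i (by omega)
    have h2 := h n (by omega)
    have h3 := n1Z_add_le (∑ i ∈ Finset.range n, f i) (f n)
    push_cast
    linarith

lemma U_sum_ge {d : ℕ} (U : Zd d →+ ℝ) (f : ℕ → Zd d) (n : ℕ) (h : ∀ i < n, 1 ≤ U (f i)) :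
    (n : ℝ) ≤ U (∑ i ∈ Finset.range n, f i) := by
  induction n with
  | zero => simp
  | succ n ih =>
    rw [Finset.sum_range_succ, map_add]
    have := ih fun i hi => h i (by omega)
    have h2 := h n (by omega)
    push_cast
    linarith

lemma exists_U {d : ℕ} (R : Finset (Zd d)) (h0 : (0 : Fin d → ℝ) ∉ hullU R) :
    ∃ (U : Zd d →+ ℝ) (Ku : ℝ), 0 < Ku ∧ (∀ x, |U x| ≤ Ku * n1Z x) ∧ ∀ z ∈ R, 1 ≤ U z := by
  have hcl : IsClosed (hullU R) :=
    ((R.finite_toSet.image toR).isCompact_convexHull ℝ).isClosed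
  obtain ⟨f, u, hf0, hfu⟩ := geometric_hahn_banach_point_closed (convex_convexHull ℝ _) hcl h0
  rw [map_zero] at hf0
  have hf : ∀ v : Fin d → ℝ, f v = ∑ i, v i * f (Pi.single i 1) := by
    intro v
    conv_lhs => rw [← Finset.univ_sum_single v]
    rw [map_sum]
    refine Finset.sum_congr rfl fun i _ => ?_
    have : (Pi.single i (v i) : Fin d → ℝ) = v i • Pi.single i (1 : ℝ) := by
      rw [← Pi.single_smul]; simp
    rw [this, map_smul, smul_eq_mul]
  have hadd : ∀ x y : Zd d, toR (x + y) = toR x + toR y := by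
    intro x y; ext i; simp [toR]
  refine ⟨AddMonoidHom.mk' (fun x => u⁻¹ * f (toR x)) ?_,
    u⁻¹ * (∑ i, |f (Pi.single i 1)| + 1), ?_, ?_, ?_⟩
  · intro a b; rw [hadd, map_add, mul_add]
  · have : 0 ≤ ∑ i, |f (Pi.single i 1)| := Finset.sum_nonneg fun _ _ => abs_nonneg _
    positivity
  · intro x
    simp only [AddMonoidHom.mk'_apply]
    rw [abs_mul, abs_of_pos (inv_pos.2 hf0), mul_assoc]
    refine mul_le_mul_of_nonneg_left ?_ (inv_pos.2 hf0).le
    rw [hf]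
    refine (Finset.abs_sum_le_sum_abs _ _).trans ?_
    unfold n1Z n1
    rw [Finset.mul_sum]
    refine Finset.sum_le_sum fun i _ => ?_
    rw [abs_mul, mul_comm]
    refine mul_le_mul_of_nonneg_right ?_ (abs_nonneg _)
    have := Finset.single_le_sum (f := fun i => |f (Pi.single i 1)|) (fun _ _ => abs_nonneg _) (Finset.mem_univ i)
    linarith
  · intro z hz
    simp only [AddMonoidHom.mk'_apply]
    have := hfu (toR z) (subset_convexHull ℝ _ ⟨z, hz, rfl⟩)
    rw [inv_mul_eq_div, le_div_iff₀ hf0]; linarith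

/-- chain generating function -/
def Phi {d : ℕ} (B : Set (Zd d)) (U : Zd d →+ ℝ) (κ : ℕ) (lam : ℝ) : ℕ → Zd d → ℝ≥0∞
  | 0, _ => 1
  | m + 1, x => ∑' v : Zd d, if (κ : ℝ) ≤ U v then
      ENNReal.ofReal (Real.exp (-(lam * n1Z v))) *
        ((if x + v ∈ B then 1 else 0) * Phi B U κ lam m (x + v)) else 0

lemma pos_add {d : ℕ} (x : Zd d) (f : ℕ → Zd d) (i j : ℕ) :
    pos x f (j + i) = pos (pos x f j) (fun l => f (j + l)) i := by
  simp [pos, Finset.sum_range_add, add_assoc]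

lemma Phi_lower {d : ℕ} (B : Set (Zd d)) (U : Zd d →+ ℝ) (κ : ℕ) (lam K : ℝ) (hlam : 0 ≤ lam)
    (hK : 0 ≤ K) (m : ℕ) : ∀ (x : Zd d) (n : ℕ) (f : ℕ → Zd d) (_ : ∀ i < n, 1 ≤ U (f i))
    (_ : ∀ i < n, n1Z (f i) ≤ K)
    (_ : κ * m < ((Finset.range n).filter fun i => pos x f i ∈ B).card),
    ENNReal.ofReal (Real.exp (-(lam * K * n))) ≤ Phi B U κ lam m x := by
  induction m with
  | zero =>
    intro x n f _ _ _
    simp only [Phi]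
    rw [ENNReal.ofReal_le_one, Real.exp_le_one_iff]
    have : 0 ≤ lam * K * n := by positivity
    linarith
  | succ m ih =>
    intro x n f hfU hfK hc
    set S := (Finset.range n).filter fun i => pos x f i ∈ B with hS
    have hex : ∃ j, κ ≤ j ∧ j ∈ S := by
      by_contra! hcon
      have hsub : S ⊆ Finset.range κ := by
        intro i hi
        rw [Finset.mem_range]
        by_contra h
        exact hcon i (by omega) hi
      have := Finset.card_le_card hsub
      rw [Finset.card_range] at this
      have : κ * (m + 1) = κ * m + κ := by ring
      omega
    obtain ⟨hj1, hj2⟩ := Nat.find_spec hex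
    set j := Nat.find hex with hj
    have hmin : ∀ i < j, ¬ (κ ≤ i ∧ i ∈ S) := fun i hi => Nat.find_min hex hi
    have hjn : j < n ∧ pos x f j ∈ B := by simpa [hS] using hj2
    set S' := (Finset.range (n - j)).filter fun i => pos (pos x f j) (fun l => f (j + l)) i ∈ B with hS'
    have hsub : S ⊆ Finset.range κ ∪ S'.image (fun i => j + i) := by
      intro i hi
      rw [Finset.mem_union, Finset.mem_range, Finset.mem_image]
      by_cases h : i < κ
      · exact Or.inl h
      · right
        have hij : j ≤ i := by
          by_contra h'
          exact hmin i (by omega) ⟨by omega, hi⟩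
        have hi' : i < n ∧ pos x f i ∈ B := by simpa [hS] using hi
        refine ⟨i - j, ?_, by omega⟩
        rw [hS', Finset.mem_filter, Finset.mem_range, ← pos_add]
        refine ⟨by omega, ?_⟩
        rw [show j + (i - j) = i by omega]
        exact hi'.2
    have hcard : κ * m < S'.card := by
      have h1 := Finset.card_le_card hsub
      have h2 := Finset.card_union_le (Finset.range κ) (S'.image (fun i => j + i))
      have h3 : (S'.image (fun i => j + i)).card ≤ S'.card := Finset.card_image_le
      rw [Finset.card_range] at h2
      have : κ * (m + 1) = κ * m + κ := by ring
      omega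
    have hrec := ih (pos x f j) (n - j) (fun l => f (j + l)) (fun i hi => hfU _ (by omega))
      (fun i hi => hfK _ (by omega)) hcard
    simp only [Phi]
    set v := ∑ i ∈ Finset.range j, f i with hv
    have hxv : x + v = pos x f j := rfl
    refine le_trans ?_ (ENNReal.le_tsum v)
    have hUv : (κ : ℝ) ≤ U v := by
      have := U_sum_ge U f j (fun i hi => hfU i (by omega))
      have h2 : (κ : ℝ) ≤ j := by exact_mod_cast hj1
      linarith
    have hKv : n1Z v ≤ j * K := n1Z_sum_le f j K (fun i hi => hfK i (by omega))
    rw [if_pos hUv, hxv, if_pos hjn.2, one_mul]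
    refine le_trans ?_ (mul_le_mul' le_rfl hrec)
    rw [← ENNReal.ofReal_mul (Real.exp_pos _).le, ← Real.exp_add]
    refine ENNReal.ofReal_le_ofReal (Real.exp_le_exp.2 ?_)
    rw [Nat.cast_sub hjn.1.le]
    have := mul_le_mul_of_nonneg_left hKv hlam
    nlinarith

lemma pt_bound (w : ℝ) (j0 J : ℕ) (hJ : j0 ≤ J) (hw : w ≤ 2 ^ J) :
    w ≤ 2 ^ j0 + ∑ j ∈ Finset.Ico j0 J, 2 ^ (j + 1) * (if (2 : ℝ) ^ j < w then 1 else 0) := by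
  induction J, hJ using Nat.le_induction with
  | base => simpa using hw
  | succ J hJ ih =>
    rw [Finset.sum_Ico_succ_top hJ]
    by_cases h : (2 : ℝ) ^ J < w
    · rw [if_pos h, mul_one]
      have : 0 ≤ ∑ j ∈ Finset.Ico j0 J, (2 : ℝ) ^ (j + 1) * (if (2 : ℝ) ^ j < w then 1 else 0) :=
        Finset.sum_nonneg fun _ _ => by positivity
      have : (0 : ℝ) < 2 ^ j0 := by positivity
      linarith
    · rw [if_neg h, mul_zero, add_zero]
      exact ih (not_lt.1 h)

lemma sum_bound (w : ℕ → ℝ) (n j0 J : ℕ) (hJ : j0 ≤ J) (hw : ∀ i < n, w i ≤ 2 ^ J) (c : ℕ → ℝ)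
    (hc : ∀ j ∈ Finset.Ico j0 J,
      (((Finset.range n).filter fun i => (2 : ℝ) ^ j < w i).card : ℝ) ≤ c j) :
    ∑ i ∈ Finset.range n, w i ≤ n * 2 ^ j0 + ∑ j ∈ Finset.Ico j0 J, 2 ^ (j + 1) * c j := by
  calc ∑ i ∈ Finset.range n, w i ≤ ∑ i ∈ Finset.range n, ((2 : ℝ) ^ j0 +
        ∑ j ∈ Finset.Ico j0 J, 2 ^ (j + 1) * (if (2 : ℝ) ^ j < w i then 1 else 0)) :=
        Finset.sum_le_sum fun i hi => pt_bound _ _ _ hJ (hw i (Finset.mem_range.1 hi))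
    _ = n * 2 ^ j0 + ∑ j ∈ Finset.Ico j0 J, 2 ^ (j + 1) *
        (((Finset.range n).filter fun i => (2 : ℝ) ^ j < w i).card : ℝ) := by
        rw [Finset.sum_add_distrib, Finset.sum_comm]
        simp only [← Finset.mul_sum, Finset.sum_boole, Finset.sum_const, Finset.card_range,
          nsmul_eq_mul]
    _ ≤ _ := by
        gcongr with j hj
        exact hc j hj

end RWRP

namespace RWRP

lemma tsum_Z_le (lam : ℝ) (h0 : 0 < lam) (h1 : lam ≤ 1) :
    ∑' k : ℤ, ENNReal.ofReal (Real.exp (-(lam * |(k : ℝ)|))) ≤ ENNReal.ofReal (4 / lam) := by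
  have hgeo : ∑' n : ℕ, ENNReal.ofReal (Real.exp (-(lam * n))) ≤ ENNReal.ofReal (2 / lam) := by
    have hlt : Real.exp (-lam) < 1 := by rw [Real.exp_lt_one_iff]; linarith
    have : ∀ n : ℕ, ENNReal.ofReal (Real.exp (-(lam * n))) = ENNReal.ofReal (Real.exp (-lam)) ^ n := by
      intro n
      rw [← ENNReal.ofReal_pow (Real.exp_pos _).le, ← Real.exp_nat_mul]
      congr 2; ring
    simp_rw [this]
    rw [ENNReal.tsum_geometric, ← ENNReal.ofReal_one, ← ENNReal.ofReal_sub _ (Real.exp_pos _).le,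
      ← ENNReal.ofReal_inv_of_pos (by linarith)]
    refine ENNReal.ofReal_le_ofReal ?_
    rw [inv_le_comm₀ (by linarith) (by positivity), inv_div]
    have h2 : Real.exp (-lam) ≤ 1 / (1 + lam) := by
      rw [Real.exp_neg, ← one_div]
      exact one_div_le_one_div_of_le (by linarith) (by linarith [Real.add_one_le_exp lam])
    have h3 : 1 / (1 + lam) ≤ 1 - lam / 2 := by
      rw [div_le_iff₀ (by linarith)]; nlinarith
    linarith
  rw [tsum_of_nat_of_neg_add_one ENNReal.summable ENNReal.summable]
  calc _ ≤ ENNReal.ofReal (2 / lam) + ENNReal.ofReal (2 / lam) := by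
        refine add_le_add ?_ ?_
        · simpa using hgeo
        · refine le_trans (ENNReal.tsum_le_tsum fun n => ?_) hgeo
          refine ENNReal.ofReal_le_ofReal (Real.exp_le_exp.2 ?_)
          push_cast
          rw [abs_of_nonpos (by linarith [(Nat.cast_nonneg n : (0:ℝ) ≤ n)])]
          nlinarith
    _ = _ := by
        rw [← ENNReal.ofReal_add (by positivity) (by positivity)]; congr 1; ring

lemma tsum_Zd_le (lam : ℝ) (h0 : 0 < lam) (h1 : lam ≤ 1) (d : ℕ) :
    ∑' v : Zd d, ENNReal.ofReal (Real.exp (-(lam * n1Z v))) ≤ ENNReal.ofReal (4 / lam) ^ d := by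
  induction d with
  | zero =>
    rw [tsum_eq_single (0 : Zd 0) (fun b hb => absurd (Subsingleton.elim _ _) hb)]
    simp [n1Z, n1]
  | succ d ih =>
    rw [← (Fin.consEquiv (fun _ : Fin (d+1) => ℤ)).tsum_eq]
    have : ∀ c : ℤ × (Fin d → ℤ), ENNReal.ofReal (Real.exp (-(lam * n1Z
        ((Fin.consEquiv (fun _ : Fin (d+1) => ℤ)) c)))) =
        ENNReal.ofReal (Real.exp (-(lam * |(c.1 : ℝ)|))) *
          ENNReal.ofReal (Real.exp (-(lam * n1Z c.2))) := by
      intro c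
      rw [← ENNReal.ofReal_mul (Real.exp_pos _).le, ← Real.exp_add]
      congr 2
      simp [n1Z, n1, toR, Fin.sum_univ_succ, Fin.consEquiv]
      ring
    simp_rw [this]
    rw [ENNReal.tsum_prod (f := fun (a : ℤ) (b : Fin d → ℤ) => ENNReal.ofReal (Real.exp (-(lam * |(a : ℝ)|))) *
          ENNReal.ofReal (Real.exp (-(lam * n1Z (d := d) b))))]
    simp_rw [ENNReal.tsum_mul_left]
    rw [ENNReal.tsum_mul_right, pow_succ']
    exact mul_le_mul' (tsum_Z_le lam h0 h1) ih

/-- sigma-algebra of the coordinates in `A` -/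
abbrev Fs {d : ℕ} (Γ : Type*) [MeasurableSpace Γ] (A : Set (Zd d)) : MeasurableSpace (Zd d → Γ) :=
  ⨆ x ∈ A, MeasurableSpace.comap (fun ω : Zd d → Γ => ω x) inferInstance

lemma Fs_le {d : ℕ} {Γ : Type*} [MeasurableSpace Γ] (A : Set (Zd d)) :
    Fs Γ A ≤ MeasurableSpace.pi :=
  iSup₂_le fun x _ => (measurable_pi_apply x).comap_le

lemma Fs_mono {d : ℕ} {Γ : Type*} [MeasurableSpace Γ] {A B : Set (Zd d)} (h : A ⊆ B) :
    Fs Γ A ≤ Fs Γ B := biSup_mono fun _ hx => h hx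

lemma Fs_shift {d : ℕ} {Γ : Type*} [MeasurableSpace Γ] (A A' : Set (Zd d)) (y : Zd d)
    (h : ∀ x ∈ A, y + x ∈ A') :
    Measurable[Fs Γ A', Fs Γ A] (shiftT (Γ := Γ) y) := by
  rw [measurable_iff_comap_le, MeasurableSpace.comap_iSup]
  refine iSup_le fun x => ?_
  rw [MeasurableSpace.comap_iSup]
  refine iSup_le fun hx => ?_
  rw [MeasurableSpace.comap_comp]
  exact le_iSup₂_of_le (y + x) (h x hx) le_rfl

section
variable {d : ℕ} {Γ : Type*} [MeasurableSpace Γ] (U : Zd d →+ ℝ) (Ku L M : ℝ) (κ : ℕ)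
  (hKu : 0 < Ku) (hU : ∀ x, |U x| ≤ Ku * n1Z x) (E : Set (Zd d → Γ))
  (hE : MeasurableSet[Fs Γ {x : Zd d | n1Z x ≤ L}] E)

/-- bad sites -/
def bad (E : Set (Zd d → Γ)) (ω : Zd d → Γ) : Set (Zd d) := {y | shiftT y ω ∈ E}

include hKu hU hE in
lemma ind_meas (y : Zd d) : Measurable[Fs Γ {x | U y - Ku * L ≤ U x ∧ U x ≤ U y + Ku * L}]
    (fun ω => if y ∈ bad E ω then (1 : ℝ≥0∞) else 0) := by
  have h := Fs_shift (Γ := Γ) {x : Zd d | n1Z x ≤ L}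
    {x | U y - Ku * L ≤ U x ∧ U x ≤ U y + Ku * L} y (by
      intro x hx
      have h1 := abs_le.1 (hU x)
      have h2 := mul_le_mul_of_nonneg_left (show n1Z x ≤ L from hx) hKu.le
      simp only [Set.mem_ofPred_eq, map_add]
      constructor <;> linarith)
  have h3 := h hE
  exact @Measurable.ite _ _ (_) _ _ _ _ _ h3 (@measurable_const _ _ _ (_) _)
    (@measurable_const _ _ _ (_) _)

include hKu hU hE in
lemma Phi_meas (lam : ℝ) (m : ℕ) : ∀ x : Zd d, Measurable[Fs Γ {y | U x + κ - Ku * L ≤ U y}]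
    (fun ω => Phi (bad E ω) U κ lam m x) := by
  induction m with
  | zero => intro x; simp only [Phi]; exact @measurable_const _ _ _ (_) _
  | succ m ih =>
    intro x
    simp only [Phi]
    refine @Measurable.ennreal_tsum _ (_) _ _ _ fun v => ?_
    by_cases hv : (κ : ℝ) ≤ U v
    · simp only [if_pos hv]
      refine @Measurable.const_mul _ _ _ _ _ (_) _ ?_ _
      refine @Measurable.mul _ _ _ _ _ (_) _ _ ?_ ?_
      · refine (ind_meas U Ku L hKu hU E hE (x + v)).mono (Fs_mono ?_) le_rfl
        rintro y ⟨hy, -⟩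
        rw [map_add] at hy
        simp only [Set.mem_ofPred_eq]
        linarith
      · refine (ih (x + v)).mono (Fs_mono ?_) le_rfl
        intro y hy
        simp only [Set.mem_ofPred_eq, map_add] at hy ⊢
        have : (0 : ℝ) ≤ κ := Nat.cast_nonneg _
        linarith
    · simp only [if_neg hv]; exact @measurable_const _ _ _ (_) _

include hKu hU hE in
lemma Phi_int (ℙ : Measure (Zd d → Γ)) [IsProbabilityMeasure ℙ]
    (hT : ∀ z : Zd d, MeasurePreserving (shiftT (Γ := Γ) z) ℙ ℙ)
    (hM : ∀ A B : Set (Zd d),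
      (∀ x ∈ A, ∀ y ∈ B, M < n1Z (x - y)) →
      ProbabilityTheory.Indep (Fs Γ A) (Fs Γ B) ℙ)
    (hκ : Ku * (M + 2 * L) < κ) (lam : ℝ) (h0 : 0 < lam) (h1 : lam ≤ 1) (m : ℕ) :
    ∀ x : Zd d, ∫⁻ ω, Phi (bad E ω) U κ lam m x ∂ℙ ≤ (ENNReal.ofReal (4 / lam) ^ d * ℙ E) ^ m := by
  induction m with
  | zero => intro x; simp [Phi]
  | succ m ih =>
    intro x
    have hmi : ∀ y, Measurable (fun ω => if y ∈ bad E ω then (1 : ℝ≥0∞) else 0) := fun y =>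
      (ind_meas U Ku L hKu hU E hE y).mono (Fs_le _) le_rfl
    have hmP : ∀ y, Measurable (fun ω => Phi (bad E ω) U κ lam m y) := fun y =>
      (Phi_meas U Ku L κ hKu hU E hE lam m y).mono (Fs_le _) le_rfl
    have hmm : ∀ y, Measurable (fun ω => (if y ∈ bad E ω then (1 : ℝ≥0∞) else 0) *
        Phi (bad E ω) U κ lam m y) := fun y => (hmi y).mul (hmP y)
    have hprod : ∀ y, ∫⁻ ω, (if y ∈ bad E ω then (1 : ℝ≥0∞) else 0) * Phi (bad E ω) U κ lam m y ∂ℙ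
        ≤ ℙ E * (ENNReal.ofReal (4 / lam) ^ d * ℙ E) ^ m := by
      intro y
      rw [ProbabilityTheory.lintegral_mul_eq_lintegral_mul_lintegral_of_independent_measurableSpace
        (Fs_le _) (Fs_le _) (hM {x | U y - Ku * L ≤ U x ∧ U x ≤ U y + Ku * L}
          {x | U y + κ - Ku * L ≤ U x} ?_) (ind_meas U Ku L hKu hU E hE y)
          (Phi_meas U Ku L κ hKu hU E hE lam m y)]
      · refine mul_le_mul' ?_ (ih y)
        have hEm : MeasurableSet E := Fs_le _ _ hE
        rw [← (hT y).measure_preimage hEm.nullMeasurableSet, ← lintegral_indicator_one ((hT y).measurable hEm)]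
        exact le_of_eq rfl
      · rintro a ⟨-, ha⟩ b hb
        simp only [Set.mem_ofPred_eq] at hb
        have h3 := (abs_le.1 (hU (a - b))).1
        rw [map_sub] at h3
        have : Ku * M < Ku * n1Z (a - b) := by linarith
        exact lt_of_mul_lt_mul_left this hKu.le
    simp only [Phi]
    rw [lintegral_tsum]
    · calc _ ≤ ∑' v : Zd d, ENNReal.ofReal (Real.exp (-(lam * n1Z v))) *
            (ℙ E * (ENNReal.ofReal (4 / lam) ^ d * ℙ E) ^ m) := by
            refine ENNReal.tsum_le_tsum fun v => ?_
            by_cases hv : (κ : ℝ) ≤ U v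
            · simp only [if_pos hv]
              rw [lintegral_const_mul _ (hmm _)]
              exact mul_le_mul' le_rfl (hprod _)
            · simp [if_neg hv]
        _ ≤ ENNReal.ofReal (4 / lam) ^ d * (ℙ E * (ENNReal.ofReal (4 / lam) ^ d * ℙ E) ^ m) := by
            rw [ENNReal.tsum_mul_right]
            exact mul_le_mul' (tsum_Zd_le lam h0 h1 d) le_rfl
        _ = _ := by rw [pow_succ]; ring
    · intro v
      by_cases hv : (κ : ℝ) ≤ U v
      · simp only [if_pos hv]
        exact ((hmm _).const_mul _).aemeasurable
      · simp [if_neg hv]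

end
end RWRP

namespace RWRP

section
variable {d : ℕ} {Γ : Type*} [MeasurableSpace Γ] (U : Zd d →+ ℝ) (Ku L M : ℝ) (κ : ℕ)
  (hKu : 0 < Ku) (hU : ∀ x, |U x| ≤ Ku * n1Z x)

include hKu hU in
lemma G_le (E : Set (Zd d → Γ))
    (hE : MeasurableSet[Fs Γ {x : Zd d | n1Z x ≤ L}] E) (ℙ : Measure (Zd d → Γ)) [IsProbabilityMeasure ℙ]
    (hT : ∀ z : Zd d, MeasurePreserving (shiftT (Γ := Γ) z) ℙ ℙ)
    (hM : ∀ A B : Set (Zd d),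
      (∀ x ∈ A, ∀ y ∈ B, M < n1Z (x - y)) →
      ProbabilityTheory.Indep (Fs Γ A) (Fs Γ B) ℙ)
    (hκ : Ku * (M + 2 * L) < κ) (lam : ℝ) (h0 : 0 < lam) (h1 : lam ≤ 1)
    (hr : ENNReal.ofReal (4 / lam) ^ d * ℙ E ≤ ENNReal.ofReal (Real.exp (-2)))
    (a : ℝ) (ha : 0 < a) :
    ℙ {ω | ENNReal.ofReal (Real.exp (-a)) ≤ Phi (bad E ω) U κ lam ⌈a⌉₊ 0} ≤
      ENNReal.ofReal (1 / a) := by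
  have hmP : Measurable (fun ω => Phi (bad E ω) U κ lam ⌈a⌉₊ 0) :=
      (Phi_meas U Ku L κ hKu hU E hE lam _ 0).mono (Fs_le _) le_rfl
  have hmk := mul_meas_ge_le_lintegral (μ := ℙ) hmP (ENNReal.ofReal (Real.exp (-a)))
  have hint := Phi_int U Ku L M κ hKu hU E hE ℙ hT hM hκ lam h0 h1 ⌈a⌉₊ 0
  have h2 : ENNReal.ofReal (Real.exp (-a)) *
      ℙ {ω | ENNReal.ofReal (Real.exp (-a)) ≤ Phi (bad E ω) U κ lam ⌈a⌉₊ 0} ≤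
      ENNReal.ofReal (Real.exp (-a)) * ENNReal.ofReal (1 / a) := by
    refine hmk.trans (hint.trans ((pow_le_pow_left' hr _).trans ?_))
    rw [← ENNReal.ofReal_pow (Real.exp_pos _).le, ← Real.exp_nat_mul,
      ← ENNReal.ofReal_mul (Real.exp_pos _).le]
    refine ENNReal.ofReal_le_ofReal ?_
    have h3 : a ≤ ⌈a⌉₊ := Nat.le_ceil a
    have h4 : Real.exp (⌈a⌉₊ * (-2)) ≤ Real.exp (-a) * Real.exp (-a) := by
      rw [← Real.exp_add]; exact Real.exp_le_exp.2 (by linarith)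
    refine h4.trans (mul_le_mul_of_nonneg_left ?_ (Real.exp_pos _).le)
    rw [Real.exp_neg, ← one_div]
    exact one_div_le_one_div_of_le ha (by linarith [Real.add_one_le_exp a])
  rwa [ENNReal.mul_le_mul_iff_right (by simpa using Real.exp_pos _) ENNReal.ofReal_ne_top] at h2

/-- bad event -/
def Ev (V : (Zd d → Γ) → Zd d → ℝ) (R : Finset (Zd d)) (t : ℝ) : Set (Zd d → Γ) :=
  {ω | ∃ z ∈ R, V ω z < -t}

lemma Ev_meas (V : (Zd d → Γ) → Zd d → ℝ) (R : Finset (Zd d)) (m : MeasurableSpace (Zd d → Γ))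
    (h : ∀ z ∈ R, @Measurable _ _ m _ (fun ω => V ω z)) (t : ℝ) : MeasurableSet[m] (Ev V R t) := by
  have : Ev V R t = ⋃ z ∈ R, (fun ω => V ω z) ⁻¹' (Set.Iio (-t)) := by
    ext ω; simp [Ev]
  rw [this]
  exact @Finset.measurableSet_biUnion _ _ m _ R fun z hz => h z hz measurableSet_Iio

lemma Ev_tail (V : (Zd d → Γ) → Zd d → ℝ) (R : Finset (Zd d)) (ℙ : Measure (Zd d → Γ))
    (hV : ∀ z, Measurable fun ω => V ω z) (q : ℝ) (hq : 0 < q)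
    (hmom : ∀ z ∈ R, ∫⁻ ω, ENNReal.ofReal (max (-(V ω z)) 0 ^ q) ∂ℙ < ⊤) :
    ∃ c : ℝ, 0 ≤ c ∧ ∀ t : ℝ, 0 < t → ℙ (Ev V R t) ≤ ENNReal.ofReal (c * t ^ (-q)) := by
  set I := ∑ z ∈ R, ∫⁻ ω, ENNReal.ofReal (max (-(V ω z)) 0 ^ q) ∂ℙ with hI
  have hIt : I ≠ ⊤ := (ENNReal.sum_lt_top.2 hmom).ne
  refine ⟨I.toReal, ENNReal.toReal_nonneg, fun t ht => ?_⟩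
  have htq : 0 < t ^ q := Real.rpow_pos_of_pos ht q
  have h1 : ∀ z ∈ R, ENNReal.ofReal (t ^ q) * ℙ {ω | V ω z < -t} ≤
      ∫⁻ ω, ENNReal.ofReal (max (-(V ω z)) 0 ^ q) ∂ℙ := by
    intro z hz
    refine le_trans (mul_le_mul' le_rfl (measure_mono ?_)) (mul_meas_ge_le_lintegral (μ := ℙ)
      (f := fun ω => ENNReal.ofReal (max (-(V ω z)) 0 ^ q)) ?_ _)
    · intro ω hω
      have hω' : V ω z < -t := hω
      refine ENNReal.ofReal_le_ofReal (Real.rpow_le_rpow ht.le ?_ hq.le)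
      exact le_max_of_le_left (by linarith)
    · exact (((hV z).neg.max measurable_const).pow_const q).ennreal_ofReal
  have h2 : ENNReal.ofReal (t ^ q) * ℙ (Ev V R t) ≤ I := by
    have : ℙ (Ev V R t) ≤ ∑ z ∈ R, ℙ {ω | V ω z < -t} := by
      refine le_trans (measure_mono ?_) (measure_biUnion_finset_le R fun z => {ω | V ω z < -t})
      rintro ω ⟨z, hz, h⟩
      exact Set.mem_biUnion hz h
    refine (mul_le_mul' le_rfl this).trans ?_
    rw [Finset.mul_sum]
    exact Finset.sum_le_sum h1
  have h3 : ENNReal.ofReal (t ^ q) * ℙ (Ev V R t) ≤ ENNReal.ofReal (t ^ q) *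
      ENNReal.ofReal (I.toReal * t ^ (-q)) := by
    rw [← ENNReal.ofReal_mul htq.le]
    have : t ^ q * (I.toReal * t ^ (-q)) = I.toReal := by
      rw [Real.rpow_neg ht.le]; field_simp
    rwa [this, ENNReal.ofReal_toReal hIt]
  rwa [ENNReal.mul_le_mul_iff_right (by simpa using htq) ENNReal.ofReal_ne_top] at h3

lemma exists_s (q : ℝ) (hq : (d : ℝ) < q) : ∃ s : ℝ, 1 < s ∧ d * s ^ 2 < q := by
  have h : ContinuousAt (fun s : ℝ => (d : ℝ) * s ^ 2) 1 := by fun_prop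
  have h2 : ∀ᶠ s in 𝓝 (1 : ℝ), (d : ℝ) * s ^ 2 < q := h.eventually_lt continuousAt_const (by simpa using hq)
  have h3 : ∀ᶠ s in 𝓝[>] (1 : ℝ), (d : ℝ) * s ^ 2 < q := h2.filter_mono nhdsWithin_le_nhds
  obtain ⟨s, hs1, hs2⟩ := (h3.and self_mem_nhdsWithin).exists
  exact ⟨s, hs2, hs1⟩

lemma box_le (E : Set (Zd d → Γ)) (hE : MeasurableSet E) (ℙ : Measure (Zd d → Γ)) [IsProbabilityMeasure ℙ]
    (hT : ∀ z : Zd d, MeasurePreserving (shiftT (Γ := Γ) z) ℙ ℙ) (N : ℕ) :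
    ℙ {ω | ∃ x : Zd d, (∀ i, |x i| ≤ N) ∧ x ∈ bad E ω} ≤ (2 * N + 1) ^ d * ℙ E := by
  set S : Finset (Zd d) := Fintype.piFinset fun _ => Finset.Icc (-(N : ℤ)) N with hS
  refine le_trans (measure_mono (t := ⋃ x ∈ S, shiftT x ⁻¹' E) ?_) ?_
  · rintro ω ⟨x, hx, hb⟩
    refine Set.mem_biUnion (x := x) ?_ hb
    rw [Finset.mem_coe, hS, Fintype.mem_piFinset]
    intro i
    rw [Finset.mem_Icc]
    exact abs_le.1 (hx i)
  · refine (measure_biUnion_finset_le _ _).trans ?_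
    rw [Finset.sum_congr rfl fun x _ => (hT x).measure_preimage hE.nullMeasurableSet]
    rw [Finset.sum_const, nsmul_eq_mul]
    refine mul_le_mul' (le_of_eq ?_) le_rfl
    rw [hS, Fintype.card_piFinset]
    simp only [Int.card_Icc, Finset.prod_const, Finset.card_univ, Fintype.card_fin]
    have : ((N : ℤ) + 1 - -(N : ℤ)).toNat = 2 * N + 1 := by omega
    rw [this]; push_cast; rfl

end
end RWRP

namespace RWRP

/-- deterministic estimate -/
lemma det_bound {d : ℕ} {Γ : Type*} [MeasurableSpace Γ] (U : Zd d →+ ℝ) (κ K : ℕ)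
    (R : Finset (Zd d)) (hU1 : ∀ z ∈ R, 1 ≤ U z) (hK : ∀ z ∈ R, n1Z z ≤ K)
    (V : (Zd d → Γ) → Zd d → ℝ) (s : ℝ) (hs : 1 < s) (j0 J k : ℕ) (hJ : j0 ≤ J)
    (hJk : (2 : ℝ) ^ J ≤ 2 ^ (j0 + 1) * 2 ^ k) (ω : Zd d → Γ)
    (hG : ∀ j ∈ Finset.Ico j0 J, Phi (bad (Ev V R (2 ^ j)) ω) U κ ((2 : ℝ) ^ (-s * j))
      ⌈(2 : ℝ) ^ (-s * j) * K * 2 ^ k⌉₊ 0 <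
        ENNReal.ofReal (Real.exp (-((2 : ℝ) ^ (-s * j) * K * 2 ^ k))))
    (hH : ∀ x : Zd d, (∀ i, |x i| ≤ (K * 2 ^ k : ℕ)) → x ∉ bad (Ev V R (2 ^ J)) ω)
    (n : ℕ) (hn : n ≤ 2 ^ k) (f : ℕ → Zd d) (hf : ∀ i < n, f i ∈ R) :
    -(pathV shiftT V ω 0 n f) ≤
      (2 ^ j0 + 2 * κ * K * (1 - (2 : ℝ) ^ (1 - s))⁻¹ + 2 * κ * 2 ^ (j0 + 1)) * 2 ^ k := by
  have hnR : (n : ℝ) ≤ 2 ^ k := by exact_mod_cast hn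
  set w : ℕ → ℝ := fun i => -V (shiftT (pos 0 f i) ω) (f i) with hw
  have hsum : -(pathV shiftT V ω 0 n f) = ∑ i ∈ Finset.range n, w i := by
    simp [pathV, hw]
  have hbad : ∀ i < n, ∀ t : ℝ, t < w i → pos 0 f i ∈ bad (Ev V R t) ω := by
    intro i hi t ht
    exact ⟨f i, hf i hi, by simp only [hw] at ht; linarith⟩
  have hwJ : ∀ i < n, w i ≤ 2 ^ J := by
    intro i hi
    by_contra hcon
    refine hH (pos 0 f i) ?_ (hbad i hi _ (not_le.1 hcon))
    intro l
    have h1 : n1Z (pos 0 f i) ≤ i * K := by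
      rw [pos, zero_add]
      exact n1Z_sum_le f i K fun l hl => hK _ (hf l (by omega))
    have h2 : |((pos 0 f i) l : ℝ)| ≤ n1Z (pos 0 f i) := by
      unfold n1Z n1 toR
      exact Finset.single_le_sum (f := fun l => |((pos 0 f i) l : ℝ)|) (fun _ _ => abs_nonneg _) (Finset.mem_univ l)
    have h3 : (i : ℝ) * K ≤ K * 2 ^ k := by
      have : (i : ℝ) ≤ 2 ^ k := le_trans (by exact_mod_cast hi.le) hnR
      rw [mul_comm]
      exact mul_le_mul_of_nonneg_left this (Nat.cast_nonneg _)
    have h4 : |((pos 0 f i) l : ℝ)| ≤ K * 2 ^ k := by linarith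
    exact_mod_cast h4
  have hcount : ∀ j ∈ Finset.Ico j0 J,
      (((Finset.range n).filter fun i => (2 : ℝ) ^ j < w i).card : ℝ) ≤
        κ * ((2 : ℝ) ^ (-s * j) * K * 2 ^ k + 1) := by
    intro j hj
    have h1 : ((Finset.range n).filter fun i => (2 : ℝ) ^ j < w i).card ≤
        ((Finset.range n).filter fun i => pos 0 f i ∈ bad (Ev V R (2 ^ j)) ω).card := by
      refine Finset.card_le_card fun i hi => ?_
      rw [Finset.mem_filter, Finset.mem_range] at hi ⊢
      exact ⟨hi.1, hbad i hi.1 _ hi.2⟩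
    have hlam : 0 < (2 : ℝ) ^ (-s * j) := by positivity
    have h2 : ((Finset.range n).filter fun i => pos 0 f i ∈ bad (Ev V R (2 ^ j)) ω).card ≤
        κ * ⌈(2 : ℝ) ^ (-s * j) * K * 2 ^ k⌉₊ := by
      by_contra hcon
      have := Phi_lower (bad (Ev V R (2 ^ j)) ω) U κ ((2 : ℝ) ^ (-s * j)) K hlam.le
        (Nat.cast_nonneg _) _ 0 n f (fun i hi => hU1 _ (hf i hi)) (fun i hi => hK _ (hf i hi))
        (not_le.1 hcon)
      refine absurd (hG j hj) (not_lt.2 (le_trans (ENNReal.ofReal_le_ofReal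
        (Real.exp_le_exp.2 ?_)) this))
      have h5 : (2 : ℝ) ^ (-s * j) * K * n ≤ (2 : ℝ) ^ (-s * j) * K * 2 ^ k :=
        mul_le_mul_of_nonneg_left hnR (by positivity)
      linarith
    have h3 : (⌈(2 : ℝ) ^ (-s * j) * K * 2 ^ k⌉₊ : ℝ) ≤ (2 : ℝ) ^ (-s * j) * K * 2 ^ k + 1 :=
      (Nat.ceil_lt_add_one (by positivity)).le
    calc _ ≤ ((κ * ⌈(2 : ℝ) ^ (-s * j) * K * 2 ^ k⌉₊ : ℕ) : ℝ) := by exact_mod_cast h1.trans h2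
      _ ≤ _ := by
        push_cast
        exact mul_le_mul_of_nonneg_left h3 (Nat.cast_nonneg _)
  have hmain := sum_bound w n j0 J hJ hwJ _ hcount
  rw [hsum]
  refine hmain.trans ?_
  set ρ : ℝ := (2 : ℝ) ^ (1 - s) with hρ
  have hρ0 : 0 < ρ := by positivity
  have hρ1 : ρ < 1 := Real.rpow_lt_one_of_one_lt_of_neg (by norm_num) (by linarith)
  have hgeo : ∑ j ∈ Finset.Ico j0 J, ρ ^ j ≤ (1 - ρ)⁻¹ := by
    rw [← tsum_geometric_of_lt_one hρ0.le hρ1]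
    exact (summable_geometric_of_lt_one hρ0.le hρ1).sum_le_tsum _ (fun _ _ => by positivity)
  have hgeo2 : ∑ j ∈ Finset.Ico j0 J, (2 : ℝ) ^ j ≤ 2 ^ J := by
    calc ∑ j ∈ Finset.Ico j0 J, (2 : ℝ) ^ j ≤ ∑ j ∈ Finset.range J, (2 : ℝ) ^ j := by
          refine Finset.sum_le_sum_of_subset_of_nonneg ?_ (fun _ _ _ => by positivity)
          intro j hj
          rw [Finset.mem_Ico] at hj
          exact Finset.mem_range.2 hj.2
      _ ≤ 2 ^ J := by
          rw [geom_sum_eq (by norm_num)]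
          norm_num
  have hterm : ∀ j ∈ Finset.Ico j0 J, (2 : ℝ) ^ (j + 1) * (κ * ((2 : ℝ) ^ (-s * j) * K * 2 ^ k + 1))
      = 2 * κ * K * 2 ^ k * ρ ^ j + 2 * κ * 2 ^ j := by
    intro j _
    have : ρ ^ j = 2 ^ j * (2 : ℝ) ^ (-s * j) := by
      rw [hρ, ← Real.rpow_natCast, ← Real.rpow_mul (by norm_num), ← Real.rpow_natCast,
        ← Real.rpow_add (by norm_num)]
      congr 1; ring
    rw [this]; ring
  rw [Finset.sum_congr rfl hterm, Finset.sum_add_distrib, ← Finset.mul_sum, ← Finset.mul_sum]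
  have e1 := mul_le_mul_of_nonneg_left hgeo (show (0:ℝ) ≤ 2 * κ * K * 2 ^ k by positivity)
  have e2 := mul_le_mul_of_nonneg_left (hgeo2.trans hJk) (show (0:ℝ) ≤ 2 * κ by positivity)
  have e3 := mul_le_mul_of_nonneg_right hnR (show (0:ℝ) ≤ 2 ^ j0 by positivity)
  nlinarith

lemma main_as {d : ℕ} {Γ : Type*} [MeasurableSpace Γ] (U : Zd d →+ ℝ) (Ku L M : ℝ)
    (hKu : 0 < Ku) (hU : ∀ x, |U x| ≤ Ku * n1Z x) (ℙ : Measure (Zd d → Γ)) [IsProbabilityMeasure ℙ]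
    (hT : ∀ z : Zd d, MeasurePreserving (shiftT (Γ := Γ) z) ℙ ℙ)
    (hM : ∀ A B : Set (Zd d),
      (∀ x ∈ A, ∀ y ∈ B, M < n1Z (x - y)) →
      ProbabilityTheory.Indep (Fs Γ A) (Fs Γ B) ℙ)
    (R : Finset (Zd d)) (hU1 : ∀ z ∈ R, 1 ≤ U z)
    (V : (Zd d → Γ) → Zd d → ℝ) (hV : ∀ z, Measurable fun ω => V ω z)
    (hloc : ∀ z ∈ R, @Measurable _ _ (Fs Γ {x : Zd d | n1Z x ≤ L}) _ (fun ω => V ω z))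
    (q : ℝ) (hq : (d : ℝ) < q)
    (hmom : ∀ z ∈ R, ∫⁻ ω, ENNReal.ofReal (max (-(V ω z)) 0 ^ q) ∂ℙ < ⊤) :
    ∃ C : ℝ, 0 < C ∧ ∀ᵐ ω ∂ℙ, ∀ᶠ k : ℕ in atTop, ∀ n ≤ 2 ^ k, ∀ f : ℕ → Zd d,
      (∀ i < n, f i ∈ R) → -(pathV shiftT V ω 0 n f) ≤ C * 2 ^ k := by
  have hd0 : (0 : ℝ) ≤ d := Nat.cast_nonneg d
  have hq0 : 0 < q := by linarith
  obtain ⟨κ, hκ⟩ := exists_nat_gt (Ku * (M + 2 * L))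
  obtain ⟨K, hK1, hK⟩ : ∃ K : ℕ, 1 ≤ K ∧ ∀ z ∈ R, n1Z z ≤ K := by
    obtain ⟨K, hK⟩ := exists_nat_ge (∑ z ∈ R, n1Z z)
    refine ⟨K + 1, by omega, fun z hz => ?_⟩
    have := Finset.single_le_sum (f := n1Z) (fun _ _ => n1Z_nonneg _) hz
    push_cast; linarith
  have hK1' : (1 : ℝ) ≤ K := by exact_mod_cast hK1
  obtain ⟨c, hc0, hc⟩ := Ev_tail V R ℙ hV q hq0 hmom
  obtain ⟨s, hs, hsq⟩ := exists_s (d := d) q hq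
  have hs0 : 0 < s := by linarith
  -- the starting level
  have hds : d * s < q := by nlinarith
  obtain ⟨j0, hj0⟩ : ∃ j0 : ℕ, ∀ j ≥ j0, c * 4 ^ d * ((2 : ℝ) ^ (d * s - q)) ^ j ≤ Real.exp (-2) := by
    have ht : Tendsto (fun j : ℕ => c * 4 ^ d * ((2 : ℝ) ^ (d * s - q)) ^ j) atTop (𝓝 (c * 4 ^ d * 0)) :=
      (tendsto_pow_atTop_nhds_zero_of_lt_one (by positivity)
        (Real.rpow_lt_one_of_one_lt_of_neg (by norm_num) (by linarith))).const_mul _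
    rw [mul_zero] at ht
    have := ht.eventually_lt_const (Real.exp_pos (-2))
    obtain ⟨j0, hj0⟩ := eventually_atTop.1 this
    exact ⟨j0, fun j hj => (hj0 j hj).le⟩
  have hEm : ∀ t, MeasurableSet[Fs Γ {x : Zd d | n1Z x ≤ L}] (Ev V R t) := fun t =>
    Ev_meas V R _ hloc t
  have hr : ∀ j ≥ j0, ENNReal.ofReal (4 / (2 : ℝ) ^ (-s * j)) ^ d * ℙ (Ev V R (2 ^ j)) ≤
      ENNReal.ofReal (Real.exp (-2)) := by
    intro j hj
    refine (mul_le_mul' le_rfl (hc (2 ^ j) (by positivity))).trans ?_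
    rw [← ENNReal.ofReal_pow (by positivity), ← ENNReal.ofReal_mul (by positivity)]
    refine ENNReal.ofReal_le_ofReal (le_trans (le_of_eq ?_) (hj0 j hj))
    rw [div_pow, ← Real.rpow_natCast 2 j, ← Real.rpow_mul (by norm_num), ← Real.rpow_natCast _ j,
      ← Real.rpow_mul (by norm_num), ← Real.rpow_natCast (2 ^ (-s * (j : ℝ))) d,
      ← Real.rpow_mul (by norm_num), div_eq_mul_inv, ← Real.rpow_neg (by norm_num)]
    have : (2 : ℝ) ^ ((d * s - q) * j) = 2 ^ (-(-s * j * d)) * 2 ^ (j * -q) := by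
      rw [← Real.rpow_add (by norm_num)]; congr 1; ring
    rw [this]; ring
  set β : ℝ := (s ^ 2)⁻¹ with hβ
  have hβ0 : 0 < β := by positivity
  have hβ1 : β ≤ 1 := inv_le_one_of_one_le₀ (by nlinarith)
  have hsβ : s * β = s⁻¹ := by rw [hβ]; field_simp
  have hs1 : s⁻¹ < 1 := inv_lt_one_of_one_lt₀ hs
  have hqβ : d - q * β < 0 := by
    have : d * s ^ 2 * β < q * β := mul_lt_mul_of_pos_right hsq hβ0
    have h2 : d * s ^ 2 * β = d := by rw [hβ]; field_simp
    linarith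
  set J : ℕ → ℕ := fun k => j0 + ⌈β * k⌉₊ with hJ
  have hJlow : ∀ k, β * k ≤ J k := by
    intro k
    have := Nat.le_ceil (β * k)
    simp only [hJ]; push_cast
    have : (0 : ℝ) ≤ j0 := Nat.cast_nonneg _
    linarith
  have hJup : ∀ k, (J k : ℝ) ≤ β * k + 1 + j0 := by
    intro k
    have := (Nat.ceil_lt_add_one (show 0 ≤ β * k by positivity)).le
    simp only [hJ]; push_cast
    linarith
  have hJk : ∀ k, (2 : ℝ) ^ J k ≤ 2 ^ (j0 + 1) * 2 ^ k := by
    intro k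
    rw [← pow_add]
    refine pow_le_pow_right₀ (by norm_num) ?_
    have : ⌈β * k⌉₊ ≤ k := by
      refine Nat.ceil_le.2 ?_
      have : (0 : ℝ) ≤ k := Nat.cast_nonneg _
      nlinarith
    simp only [hJ]; omega
  set G : ℕ → ℕ → Set (Zd d → Γ) := fun k j => {ω |
    ENNReal.ofReal (Real.exp (-((2 : ℝ) ^ (-s * j) * K * 2 ^ k))) ≤
      Phi (bad (Ev V R (2 ^ j)) ω) U κ ((2 : ℝ) ^ (-s * j)) ⌈(2 : ℝ) ^ (-s * j) * K * 2 ^ k⌉₊ 0} with hG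
  set H : ℕ → Set (Zd d → Γ) := fun k =>
    {ω | ∃ x : Zd d, (∀ i, |x i| ≤ (K * 2 ^ k : ℕ)) ∧ x ∈ bad (Ev V R (2 ^ J k)) ω} with hH
  set ρ₁ : ℝ := (2 : ℝ) ^ (s⁻¹ - 1) with hρ₁
  set ρ₂ : ℝ := (2 : ℝ) ^ (d - q * β) with hρ₂
  have hGle : ∀ k, ∀ j ∈ Finset.Ico j0 (J k),
      ℙ (G k j) ≤ ENNReal.ofReal (2 ^ (s * (1 + j0)) * ρ₁ ^ k) := by
    intro k j hj
    rw [Finset.mem_Ico] at hj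
    have hlam1 : (2 : ℝ) ^ (-s * j) ≤ 1 :=
      Real.rpow_le_one_of_one_le_of_nonpos (by norm_num)
        (by have : (0 : ℝ) ≤ j := Nat.cast_nonneg _
            nlinarith)
    refine (G_le U Ku L M κ hKu hU _ (hEm (2 ^ j)) ℙ hT hM hκ ((2 : ℝ) ^ (-s * j)) (by positivity) hlam1
      (hr j hj.1) ((2 : ℝ) ^ (-s * j) * K * 2 ^ k) (by positivity)).trans ?_
    refine ENNReal.ofReal_le_ofReal ?_
    have h1 : (2 : ℝ) ^ (-(s * (1 + j0))) * 2 ^ ((1 - s⁻¹) * k) ≤ (2 : ℝ) ^ (-s * j) * K * 2 ^ k := by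
      have e1 : (2 : ℝ) ^ (-s * J k) ≤ (2 : ℝ) ^ (-s * j) := by
        refine Real.rpow_le_rpow_of_exponent_le (by norm_num) ?_
        have : (j : ℝ) ≤ J k := by exact_mod_cast hj.2.le
        nlinarith
      have e2 : (2 : ℝ) ^ (-(s * (1 + j0))) * 2 ^ ((1 - s⁻¹) * k) ≤ (2 : ℝ) ^ (-s * J k) * 2 ^ k := by
        rw [← Real.rpow_natCast 2 k, ← Real.rpow_add (by norm_num), ← Real.rpow_add (by norm_num)]
        refine Real.rpow_le_rpow_of_exponent_le (by norm_num) ?_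
        have e3 := mul_le_mul_of_nonneg_left (hJup k) hs0.le
        have e4 : s * (β * k) = s⁻¹ * k := by rw [← mul_assoc, hsβ]
        nlinarith
      have e5 : (2 : ℝ) ^ (-s * j) ≤ (2 : ℝ) ^ (-s * j) * K :=
        le_mul_of_one_le_right (by positivity) hK1'
      exact e2.trans (mul_le_mul_of_nonneg_right (e1.trans e5) (by positivity))
    refine (one_div_le_one_div_of_le (by positivity) h1).trans (le_of_eq ?_)
    rw [hρ₁, ← Real.rpow_natCast _ k, ← Real.rpow_mul (by norm_num), one_div, mul_inv,
      ← Real.rpow_neg (by norm_num), ← Real.rpow_neg (by norm_num)]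
    congr 2 <;> ring
  have hHle : ∀ k, ℙ (H k) ≤ ENNReal.ofReal ((3 * K) ^ d * c * ρ₂ ^ k) := by
    intro k
    refine (box_le _ (Fs_le _ _ (hEm (2 ^ J k))) ℙ hT (K * 2 ^ k)).trans ?_
    refine (mul_le_mul' le_rfl (hc (2 ^ J k) (by positivity))).trans ?_
    have h1 : ((2 : ℝ≥0∞) * ((K * 2 ^ k : ℕ) : ℝ≥0∞) + 1) ^ d =
        ENNReal.ofReal ((2 * (K * 2 ^ k) + 1) ^ d) := by
      rw [ENNReal.ofReal_pow (by positivity)]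
      congr 1
      rw [show (2 * ((K : ℝ) * 2 ^ k) + 1) = ((2 * (K * 2 ^ k) + 1 : ℕ) : ℝ) by push_cast; ring,
        ENNReal.ofReal_natCast]
      push_cast; ring
    rw [h1, ← ENNReal.ofReal_mul (by positivity)]
    refine ENNReal.ofReal_le_ofReal ?_
    have h2 : (2 * ((K : ℝ) * 2 ^ k) + 1) ^ d ≤ (3 * K * 2 ^ k) ^ d := by
      refine pow_le_pow_left₀ (by positivity) ?_ d
      have : (1 : ℝ) ≤ K * 2 ^ k := one_le_mul_of_one_le_of_one_le hK1' (one_le_pow₀ (by norm_num))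
      linarith
    have h3 : ((2 : ℝ) ^ J k) ^ (-q) ≤ 2 ^ (-(q * β) * k) := by
      rw [← Real.rpow_natCast 2 (J k), ← Real.rpow_mul (by norm_num)]
      refine Real.rpow_le_rpow_of_exponent_le (by norm_num) ?_
      have := mul_le_mul_of_nonneg_left (hJlow k) hq0.le
      linarith
    have h4 : ρ₂ ^ k = (2 ^ k) ^ d * 2 ^ (-(q * β) * k) := by
      rw [hρ₂, ← Real.rpow_natCast _ k, ← Real.rpow_mul (by norm_num), ← Real.rpow_natCast 2 k,
        ← Real.rpow_natCast _ d, ← Real.rpow_mul (by norm_num), ← Real.rpow_add (by norm_num)]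
      congr 1; ring
    calc _ ≤ (3 * K * 2 ^ k) ^ d * (c * 2 ^ (-(q * β) * k)) :=
          mul_le_mul h2 (mul_le_mul_of_nonneg_left h3 hc0) (by positivity) (by positivity)
      _ = _ := by rw [h4, mul_pow]; ring
  have hsummable : Summable fun k : ℕ =>
      (k : ℝ) * (2 ^ (s * (1 + j0)) * ρ₁ ^ k) + (3 * K) ^ d * c * ρ₂ ^ k := by
    have h1 : ‖ρ₁‖ < 1 := by
      rw [Real.norm_of_nonneg (by positivity)]
      exact Real.rpow_lt_one_of_one_lt_of_neg (by norm_num) (by linarith)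
    have h2 : ρ₂ < 1 := Real.rpow_lt_one_of_one_lt_of_neg (by norm_num) hqβ
    have h3 := (summable_pow_mul_geometric_of_norm_lt_one 1 h1).mul_left ((2 : ℝ) ^ (s * (1 + j0)))
    have h4 := (summable_geometric_of_lt_one (show 0 ≤ ρ₂ by positivity) h2).mul_left ((3 * K) ^ d * c)
    refine (h3.add h4).congr fun k => ?_
    simp only [pow_one]; ring
  have hE : ∀ k, ℙ ((⋃ j ∈ Finset.Ico j0 (J k), G k j) ∪ H k) ≤ ENNReal.ofReal
      ((k : ℝ) * (2 ^ (s * (1 + j0)) * ρ₁ ^ k) + (3 * K) ^ d * c * ρ₂ ^ k) := by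
    intro k
    rw [ENNReal.ofReal_add (by positivity) (by positivity)]
    refine (measure_union_le _ _).trans (add_le_add ?_ (hHle k))
    refine (measure_biUnion_finset_le _ _).trans ((Finset.sum_le_sum (hGle k)).trans ?_)
    rw [Finset.sum_const, nsmul_eq_mul, Nat.card_Ico, ENNReal.ofReal_mul (Nat.cast_nonneg k),
      ENNReal.ofReal_natCast]
    refine mul_le_mul' ?_ le_rfl
    have : J k - j0 ≤ k := by
      have : ⌈β * k⌉₊ ≤ k := by
        refine Nat.ceil_le.2 ?_
        have : (0 : ℝ) ≤ k := Nat.cast_nonneg _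
        nlinarith
      simp only [hJ]; omega
    exact_mod_cast this
  have hBC := ae_eventually_notMem (μ := ℙ) (ne_top_of_le_ne_top hsummable.tsum_ofReal_ne_top
    (ENNReal.tsum_le_tsum hE))
  have hρ1 : (2 : ℝ) ^ (1 - s) < 1 := Real.rpow_lt_one_of_one_lt_of_neg (by norm_num) (by linarith)
  refine ⟨(2 ^ j0 + 2 * κ * K * (1 - (2 : ℝ) ^ (1 - s))⁻¹ + 2 * κ * 2 ^ (j0 + 1)), ?_, ?_⟩
  · have : 0 < 1 - (2 : ℝ) ^ (1 - s) := by linarith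
    positivity
  filter_upwards [hBC] with ω hω
  filter_upwards [hω] with k hk n hn f hf
  rw [Set.mem_union, not_or] at hk
  refine det_bound U κ K R hU1 hK V s hs j0 (J k) k (Nat.le_add_right _ _) (hJk k) ω ?_ ?_ n hn f hf
  · intro j hj
    by_contra hcon
    exact hk.1 (Set.mem_biUnion (Finset.mem_coe.2 hj) (not_lt.1 hcon))
  · intro x hx hb
    exact hk.2 ⟨x, hx, hb⟩

end RWRP

namespace RWRP

lemma sum_pathW {d : ℕ} (R : Finset (Zd d)) (p : Zd d → ℝ) (hp : ∀ z ∈ R, 0 < p z ∧ p z < 1)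
    (hp1 : ∑ z ∈ R, p z = 1) (n : ℕ) :
    ∑ s : Fin n → {z : Zd d // z ∈ R}, pathW p s = 1 := by
  have h := Finset.prod_univ_sum (fun _ : Fin n => (Finset.univ : Finset {z : Zd d // z ∈ R}))
    (fun _ z => ENNReal.ofReal (p (z : Zd d)))
  rw [Fintype.piFinset_univ] at h
  have h2 : ∑ z : {z : Zd d // z ∈ R}, ENNReal.ofReal (p (z : Zd d)) = 1 := by
    rw [Finset.sum_coe_sort R (fun z => ENNReal.ofReal (p z)),
      ← ENNReal.ofReal_sum_of_nonneg (fun z hz => (hp z hz).1.le), hp1, ENNReal.ofReal_one]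
  simp only [pathW]
  rw [← h, h2, Finset.prod_const_one]

lemma walkK_le {d : ℕ} {Γ : Type*} (U : Zd d →+ ℝ) (R : Finset (Zd d)) (hU1 : ∀ z ∈ R, 1 ≤ U z)
    (p : Zd d → ℝ) (hp : ∀ z ∈ R, 0 < p z ∧ p z < 1)
    (hp1 : ∑ z ∈ R, p z = 1) (V : (Zd d → Γ) → Zd d → ℝ) (ω : Zd d → Γ) (C : ℝ) (k : ℕ)
    (h : ∀ n ≤ 2 ^ k, ∀ f : ℕ → Zd d,
      (∀ i < n, f i ∈ R) → -(pathV shiftT V ω 0 n f) ≤ C * 2 ^ k) (y : Zd d) (hy : U y ≤ 2 ^ k) :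
    walkK shiftT V p R ω 0 y ≤ ENNReal.ofReal (Real.exp ((C + 1) * 2 ^ k)) := by
  have hmem : ∀ (n : ℕ) (s : Fin n → {z : Zd d // z ∈ R}), ∀ i < n, stepF n s i ∈ R := by
    intro n s i hi
    simp only [stepF, dif_pos hi]
    exact (s _).2
  unfold walkK
  rw [tsum_eq_sum (s := Finset.range (2 ^ k))]
  · calc _ ≤ ∑ n ∈ Finset.range (2 ^ k), ENNReal.ofReal (Real.exp (C * 2 ^ k)) := by
          refine Finset.sum_le_sum fun n hn => ?_
          rw [Finset.mem_range] at hn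
          calc _ ≤ ∑ s : Fin (n + 1) → {z : Zd d // z ∈ R},
                pathW p s * ENNReal.ofReal (Real.exp (C * 2 ^ k)) := by
                refine Finset.sum_le_sum fun s _ => ?_
                split_ifs
                · refine mul_le_mul' le_rfl (ENNReal.ofReal_le_ofReal (Real.exp_le_exp.2 ?_))
                  exact h (n + 1) hn _ (hmem _ s)
                · exact zero_le
            _ = _ := by rw [← Finset.sum_mul, sum_pathW R p hp hp1, one_mul]
      _ = ENNReal.ofReal (2 ^ k * Real.exp (C * 2 ^ k)) := by
          rw [Finset.sum_const, Finset.card_range, nsmul_eq_mul, ENNReal.ofReal_mul (by positivity)]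
          congr 1
          rw [show ((2 : ℝ) ^ k) = ((2 ^ k : ℕ) : ℝ) by push_cast; rfl, ENNReal.ofReal_natCast]
      _ ≤ _ := by
          refine ENNReal.ofReal_le_ofReal ?_
          have : (C + 1) * 2 ^ k = 2 ^ k + C * 2 ^ k := by ring
          rw [this, Real.exp_add]
          refine mul_le_mul_of_nonneg_right ?_ (Real.exp_pos _).le
          linarith [Real.add_one_le_exp ((2 : ℝ) ^ k)]
  · intro n hn
    rw [Finset.mem_range, not_lt] at hn
    refine Finset.sum_eq_zero fun s _ => if_neg ?_
    rintro ⟨hpos, -⟩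
    rw [pos, zero_add] at hpos
    have h1 := U_sum_ge U (stepF (n + 1) s) (n + 1) (fun i hi => hU1 _ (hmem _ s i hi))
    rw [hpos] at h1
    have h2 : ((2 : ℝ) ^ k) ≤ n := by exact_mod_cast hn
    push_cast at h1
    linarith

end RWRP

open RWRP in
/-- lower Lyapunov bound in the i.i.d.-type product setting. -/
theorem statement15
    {d : ℕ} {Γ : Type*} [MeasurableSpace Γ]
    (ℙ : Measure (Zd d → Γ)) [IsProbabilityMeasure ℙ]
    (R : Finset (Zd d)) (V : (Zd d → Γ) → Zd d → ℝ) (p : Zd d → ℝ)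
    (hset : Setting ℙ (shiftT (d := d) (Γ := Γ)) R V p)
    (hM : ∃ M : ℝ, 0 ≤ M ∧ ∀ A B : Set (Zd d),
      (∀ x ∈ A, ∀ y ∈ B, M < n1Z (x - y)) →
      ProbabilityTheory.Indep
        (⨆ x ∈ A, MeasurableSpace.comap (fun ω : Zd d → Γ => ω x) inferInstance)
        (⨆ y ∈ B, MeasurableSpace.comap (fun ω : Zd d → Γ => ω y) inferInstance) ℙ)
    (h0U : (0 : Fin d → ℝ) ∉ hullU R)
    (hloc : ∃ L : ℝ, 0 ≤ L ∧ ∀ z ∈ R,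
      @Measurable _ _ (⨆ x ∈ {x : Zd d | n1Z x ≤ L},
        MeasurableSpace.comap (fun ω : Zd d → Γ => ω x) inferInstance) _
        (fun ω => V ω z))
    (hmom : ∃ q : ℝ, (d : ℝ) < q ∧ ∀ z ∈ R,
      ∫⁻ ω, ENNReal.ofReal (max (-(V ω z)) 0 ^ q) ∂ℙ < ⊤) :
    ∃ C : ℝ, 0 < C ∧ ∀ᵐ ω ∂ℙ, ∀ x ∈ Gp R,
      ((-(C * n1Z x) : ℝ) : EReal) ≤
        Filter.liminf (fun n : ℕ =>
          (((n : ℝ))⁻¹ : EReal) * aE (shiftT (d := d) (Γ := Γ)) V p R ω 0 (n • x))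
          Filter.atTop := by
  obtain ⟨-, -, -, hT, -, hV, hp, hp1⟩ := hset
  obtain ⟨M, -, hM⟩ := hM
  obtain ⟨L, -, hL⟩ := hloc
  obtain ⟨q, hq, hmom⟩ := hmom
  obtain ⟨U, Ku, hKu, hU, hU1⟩ := exists_U R h0U
  obtain ⟨C, hC, hae⟩ := main_as U Ku L M hKu hU ℙ hT hM R hU1 V hV hL q hq hmom
  refine ⟨(C + 1) * (2 * Ku), by positivity, ?_⟩
  filter_upwards [hae] with ω hω x _
  refine Filter.le_liminf_of_le (by isBoundedDefault) ?_
  have hx0 := n1Z_nonneg x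
  obtain ⟨k0, hk0⟩ := eventually_atTop.1 hω
  by_cases hx : x = 0
  · subst hx
    refine Eventually.of_forall fun n => ?_
    simp only [aE, smul_zero, if_true, mul_zero]
    exact_mod_cast (by simp only [neg_nonpos]; positivity : -((C + 1) * (2 * Ku) * n1Z (0 : Zd d)) ≤ 0)
  have hxpos : 0 < n1Z x := by
    rcases hx0.lt_or_eq with h | h
    · exact h
    · exfalso
      apply hx
      unfold n1Z n1 toR at h
      have := (Finset.sum_eq_zero_iff_of_nonneg (fun i _ => abs_nonneg ((x i : ℝ)))).1 h.symm
      funext i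
      simpa using this i (Finset.mem_univ i)
  have htend : Tendsto (fun n : ℕ => (n : ℝ) * (Ku * n1Z x)) atTop atTop :=
    tendsto_natCast_atTop_atTop.atTop_mul_const (by positivity)
  filter_upwards [htend.eventually_ge_atTop ((2 : ℝ) ^ k0), eventually_ge_atTop 1] with n hn hn1
  have hn0 : (0 : ℝ) < n := by exact_mod_cast hn1
  obtain ⟨k, hk1, hk2⟩ := exists_nat_pow_near
    (le_trans (one_le_pow₀ (by norm_num : (1 : ℝ) ≤ 2)) hn) (by norm_num : (1 : ℝ) < 2)
  have hkk : k0 < k + 1 := by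
    have : (2 : ℝ) ^ k0 < 2 ^ (k + 1) := lt_of_le_of_lt hn hk2
    exact (pow_lt_pow_iff_right₀ (by norm_num)).1 this
  have hUy : U (n • x) ≤ 2 ^ (k + 1) := by
    rw [map_nsmul, nsmul_eq_mul]
    have := le_trans (le_abs_self _) (hU x)
    have := mul_le_mul_of_nonneg_left this hn0.le
    linarith
  have hW := walkK_le U R hU1 p hp hp1 V ω C (k + 1) (hk0 (k + 1) hkk.le) (n • x) hUy
  have hexp : (C + 1) * 2 ^ (k + 1) ≤ n * ((C + 1) * (2 * Ku) * n1Z x) := by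
    have : (2 : ℝ) ^ (k + 1) ≤ 2 * (n * (Ku * n1Z x)) := by rw [pow_succ]; linarith
    have := mul_le_mul_of_nonneg_left this (show 0 ≤ C + 1 by linarith)
    linarith
  have hlog : ENNReal.log (walkK shiftT V p R ω 0 (n • x)) ≤
      ((n * ((C + 1) * (2 * Ku) * n1Z x) : ℝ) : EReal) := by
    refine (ENNReal.log_monotone (hW.trans (ENNReal.ofReal_le_ofReal (Real.exp_le_exp.2 hexp)))).trans ?_
    rw [ENNReal.log_ofReal_of_pos (Real.exp_pos _), Real.log_exp]
  have haE : ((-(n * ((C + 1) * (2 * Ku) * n1Z x)) : ℝ) : EReal) ≤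
      aE shiftT V p R ω 0 (n • x) := by
    unfold aE
    split_ifs
    · have h5 : -(n * ((C + 1) * (2 * Ku) * n1Z x)) ≤ 0 := by
        have : 0 ≤ n * ((C + 1) * (2 * Ku) * n1Z x) := by positivity
        linarith
      exact_mod_cast h5
    · rw [EReal.coe_neg]
      exact EReal.neg_le_neg_iff.2 hlog
  have hinv : (0 : EReal) ≤ (((n : ℝ))⁻¹ : EReal) := by
    rw [← EReal.coe_inv]; exact_mod_cast inv_nonneg.2 hn0.le
  refine le_trans (le_of_eq ?_) (mul_le_mul_of_nonneg_left haE hinv)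
  rw [← EReal.coe_inv, ← EReal.coe_mul]
  congr 1
  field_simp
end
end
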